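/- arXiv:2603.24951 — 3 statements merged into one kernel-verified Lean document; each statement's English description precedes it below -/
import Mathlib

section
/- Let φ : ℝⁿ → ℝ ∪ {+∞} be proper and lower semicontinuous, and let κ > 0. Then φ is strongly convex with modulus κ (i.e., x ↦ φ(x) − (κ/2)‖x‖² is convex) if and only if there exists ρ ≥ 0 such that φ is ρ-weakly convex and, for every (x,y) ∈ gph ∂φ and every w, z ∈ ℝⁿ with (z, −w) ∈ N̂_{gph ∂φ}(x,y), one has ⟨z,w⟩ ≥ κ‖w‖². -/
open scoped RealInnerProductSpace
open Filter Topology MeasureTheory Set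

noncomputable section

variable {n : ℕ}

/-- Convexity of an extended-real-valued function `φ : ℝⁿ → ℝ ∪ {+∞}`. -/
def ERealConvex {F : Type*} [AddCommGroup F] [Module ℝ F] (φ : F → EReal) : Prop :=
  ∀ x y : F, ∀ a b : ℝ, 0 ≤ a → 0 ≤ b → a + b = 1 →
    φ (a • x + b • y) ≤ (a : EReal) * φ x + (b : EReal) * φ y

/-- The shifted function `x ↦ φ(x) + (ρ/2)‖x‖²`. -/
def shiftFun (ρ : ℝ) (φ : EuclideanSpace ℝ (Fin n) → EReal) :
    EuclideanSpace ℝ (Fin n) → EReal :=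
  fun x => φ x + (((ρ / 2) * ‖x‖ ^ 2 : ℝ) : EReal)

/-- The subdifferential of a `ρ`-weakly convex function. -/
def subdiff (ρ : ℝ) (φ : EuclideanSpace ℝ (Fin n) → EReal)
    (x : EuclideanSpace ℝ (Fin n)) : Set (EuclideanSpace ℝ (Fin n)) :=
  {v | φ x ≠ ⊤ ∧
    ∀ u, φ x + ((⟪v, u - x⟫ - (ρ / 2) * ‖u - x‖ ^ 2 : ℝ) : EReal) ≤ φ u}

/-- Graph of the subdifferential mapping. -/
def gphSubdiff (ρ : ℝ) (φ : EuclideanSpace ℝ (Fin n) → EReal) :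
    Set (EuclideanSpace ℝ (Fin n) × EuclideanSpace ℝ (Fin n)) :=
  {p | p.2 ∈ subdiff ρ φ p.1}

/-- The (Bouligand–Severi) tangent/contingent cone to `S` at `z`. -/
def contTangentCone {F : Type*} [NormedAddCommGroup F] [NormedSpace ℝ F]
    (S : Set F) (z : F) : Set F :=
  {w | ∃ (t : ℕ → ℝ) (ws : ℕ → F), (∀ k, 0 < t k) ∧ Tendsto t atTop (𝓝 0) ∧
    Tendsto ws atTop (𝓝 w) ∧ ∀ k, z + t k • ws k ∈ S}

/-- Inner product of pairs in `ℝⁿ × ℝⁿ`. -/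
def pairInner (p q : EuclideanSpace ℝ (Fin n) × EuclideanSpace ℝ (Fin n)) : ℝ :=
  ⟪p.1, q.1⟫ + ⟪p.2, q.2⟫

/-- The (Fréchet) regular normal cone to `S` at `z`. -/
def regNormalCone (S : Set (EuclideanSpace ℝ (Fin n) × EuclideanSpace ℝ (Fin n)))
    (z : EuclideanSpace ℝ (Fin n) × EuclideanSpace ℝ (Fin n)) :
    Set (EuclideanSpace ℝ (Fin n) × EuclideanSpace ℝ (Fin n)) :=
  {v | ∀ ε > (0 : ℝ), ∃ δ > (0 : ℝ), ∀ u ∈ S, ‖u - z‖ < δ →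
      pairInner v (u - z) ≤ ε * ‖u - z‖}

/-- The (Mordukhovich) limiting normal cone to `S` at `z`. -/
def limNormalCone (S : Set (EuclideanSpace ℝ (Fin n) × EuclideanSpace ℝ (Fin n)))
    (z : EuclideanSpace ℝ (Fin n) × EuclideanSpace ℝ (Fin n)) :
    Set (EuclideanSpace ℝ (Fin n) × EuclideanSpace ℝ (Fin n)) :=
  {v | ∃ zs vs : ℕ → EuclideanSpace ℝ (Fin n) × EuclideanSpace ℝ (Fin n),
    (∀ k, zs k ∈ S) ∧ Tendsto zs atTop (𝓝 z) ∧ Tendsto vs atTop (𝓝 v) ∧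
    ∀ k, vs k ∈ regNormalCone S (zs k)}

/-- The Moreau envelope `e_λ φ`. -/
def moreau (lam : ℝ) (φ : EuclideanSpace ℝ (Fin n) → EReal)
    (x : EuclideanSpace ℝ (Fin n)) : EReal :=
  ⨅ y, (φ y + ((‖y - x‖ ^ 2 / (2 * lam) : ℝ) : EReal))

/-- Second-order difference quotient `Δ²_τ φ(x,v)(u)`. -/
def delta2 (φ : EuclideanSpace ℝ (Fin n) → EReal) (x v : EuclideanSpace ℝ (Fin n))
    (τ : ℝ) (u : EuclideanSpace ℝ (Fin n)) : EReal :=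
  ((2 / τ ^ 2 : ℝ) : EReal) * (φ (x + τ • u) - φ x - ((τ * ⟪v, u⟫ : ℝ) : EReal))

/-- The second subderivative `d²φ(x,v)(w)`. -/
def secondSubderiv (φ : EuclideanSpace ℝ (Fin n) → EReal)
    (x v w : EuclideanSpace ℝ (Fin n)) : EReal :=
  Filter.liminf (fun p : ℝ × EuclideanSpace ℝ (Fin n) => delta2 φ x v p.1 p.2)
    ((𝓝[>] (0 : ℝ)) ×ˢ 𝓝 w)

/-- Twice epi-differentiability of `φ` at `x` for `v`. -/
def TwiceEpiDiff (φ : EuclideanSpace ℝ (Fin n) → EReal)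
    (x v : EuclideanSpace ℝ (Fin n)) : Prop :=
  ∀ w : EuclideanSpace ℝ (Fin n), ∀ τ : ℕ → ℝ, (∀ k, 0 < τ k) →
    Tendsto τ atTop (𝓝 0) →
    ∃ ws : ℕ → EuclideanSpace ℝ (Fin n), Tendsto ws atTop (𝓝 w) ∧
      Tendsto (fun k => delta2 φ x v (τ k) (ws k)) atTop (𝓝 (secondSubderiv φ x v w))

/-- Generalized twice differentiability of `φ` at `x` for `v`. -/
def GenTwiceDiff (φ : EuclideanSpace ℝ (Fin n) → EReal)
    (x v : EuclideanSpace ℝ (Fin n)) : Prop :=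
  TwiceEpiDiff φ x v ∧
    ∃ (A : EuclideanSpace ℝ (Fin n) →ₗ[ℝ] EuclideanSpace ℝ (Fin n))
      (L : Submodule ℝ (EuclideanSpace ℝ (Fin n))),
      (∀ u w, ⟪A u, w⟫ = ⟪u, A w⟫) ∧
      (∀ w ∈ L, secondSubderiv φ x v w = ((⟪w, A w⟫ : ℝ) : EReal)) ∧
      (∀ w ∉ L, secondSubderiv φ x v w = (⊤ : EReal))


section Aux

set_option linter.unusedSectionVars false

variable {E : Type*} [NormedAddCommGroup E] [InnerProductSpace ℝ E]

/-- Closed epigraph of a real function on a domain. -/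
def AuxEpi (D : Set E) (G : E → ℝ) : Prop := IsClosed {p : E × ℝ | p.1 ∈ D ∧ G p.1 ≤ p.2}

lemma auxEpi_add {D : Set E} {G p : E → ℝ} (h : AuxEpi D G) (hp : Continuous p) :
    AuxEpi D (fun x => G x + p x) := by
  have hc : Continuous (fun q : E × ℝ => ((q.1, q.2 - p q.1) : E × ℝ)) := by fun_prop
  have := IsClosed.preimage hc h
  unfold AuxEpi
  convert this using 1
  ext q
  simp [le_sub_iff_add_le]

lemma auxEpi_sublevel {D : Set E} {G : E → ℝ} (h : AuxEpi D G) (c : ℝ) :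
    IsClosed {x | x ∈ D ∧ G x ≤ c} := by
  have hc : Continuous (fun x : E => ((x, c) : E × ℝ)) := by fun_prop
  exact IsClosed.preimage hc h

lemma aux_attain {D K : Set E} {G : E → ℝ} (h : AuxEpi D G) (hK : IsCompact K)
    (hne : (D ∩ K).Nonempty) : ∃ x ∈ D ∩ K, ∀ u ∈ D ∩ K, G x ≤ G u := by
  obtain ⟨x0, hx0⟩ := hne
  have key := hK.inter_iInter_nonempty (fun u : (D ∩ K : Set E) => {x | x ∈ D ∧ G x ≤ G u})
    (fun u => auxEpi_sublevel h _) (by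
      intro s
      classical
      obtain ⟨m, hm, hmin⟩ := (insert (⟨x0, hx0⟩ : (D ∩ K : Set E)) s).exists_min_image
        (fun u => G u) ⟨_, Finset.mem_insert_self _ _⟩
      refine ⟨m, m.2.2, ?_⟩
      simp only [mem_iInter]
      intro i hi
      exact ⟨m.2.1, hmin i (Finset.mem_insert_of_mem hi)⟩)
  obtain ⟨x, hxK, hx⟩ := key
  simp only [mem_iInter] at hx
  exact ⟨x, ⟨(hx ⟨x0, hx0⟩).1, hxK⟩, fun u hu => (hx ⟨u, hu⟩).2⟩

lemma aux_frechet {D : Set E} {G : E → ℝ} (hG : ConvexOn ℝ D G) {x s : E} (hx : x ∈ D) (M : ℝ)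
    (hM : ∀ u ∈ D, ‖u - x‖ ≤ 1 → G x + ⟪s, u - x⟫ - M * ‖u - x‖ ^ 2 ≤ G u) :
    ∀ u ∈ D, G x + ⟪s, u - x⟫ ≤ G u := by
  intro u hu
  have hev : ∀ᶠ t : ℝ in 𝓝[>] 0, G x + ⟪s, u - x⟫ - (M * ‖u - x‖ ^ 2) * t ≤ G u := by
    have h1 : ∀ᶠ t : ℝ in 𝓝[>] 0, t * ‖u - x‖ < 1 := by
      have : Tendsto (fun t : ℝ => t * ‖u - x‖) (𝓝[>] 0) (𝓝 (0 * ‖u - x‖)) :=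
        (Continuous.tendsto (by fun_prop) 0).mono_left nhdsWithin_le_nhds
      rw [zero_mul] at this
      exact this.eventually (gt_mem_nhds one_pos)
    have h2 : ∀ᶠ t : ℝ in 𝓝[>] 0, t < 1 := 
      nhdsWithin_le_nhds (gt_mem_nhds one_pos)
    filter_upwards [h1, h2, self_mem_nhdsWithin] with t ht1 ht2 ht0
    have ht0 : (0:ℝ) < t := ht0
    have hq := hG.2 hx hu (sub_nonneg.2 ht2.le) ht0.le (by ring)
    have hqD := hG.1 hx hu (sub_nonneg.2 ht2.le) ht0.le (by ring)
    have e : ((1 - t) • x + t • u) - x = t • (u - x) := by module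
    have h3 := hM _ hqD (by rw [e, norm_smul, Real.norm_of_nonneg ht0.le]; exact ht1.le)
    rw [e, norm_smul, Real.norm_of_nonneg ht0.le, inner_smul_right] at h3
    simp only [smul_eq_mul] at hq
    have h4 : t * (G x + ⟪s, u - x⟫ - (M * ‖u - x‖ ^ 2) * t) ≤ t * G u := by nlinarith
    exact le_of_mul_le_mul_left h4 ht0
  have hlim : Tendsto (fun t : ℝ => G x + ⟪s, u - x⟫ - (M * ‖u - x‖ ^ 2) * t) (𝓝[>] 0)
      (𝓝 (G x + ⟪s, u - x⟫ - (M * ‖u - x‖ ^ 2) * 0)) :=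
    (Continuous.tendsto (by fun_prop) 0).mono_left nhdsWithin_le_nhds
  have := le_of_tendsto hlim hev
  simpa using this

variable [FiniteDimensional ℝ E]

lemma aux_lower {D : Set E} {G : E → ℝ} (h : AuxEpi D G) (hG : ConvexOn ℝ D G) {x0 : E}
    (hx0 : x0 ∈ D) : ∃ C : ℝ, 0 ≤ C ∧ ∀ u ∈ D, G x0 - C * (1 + ‖u - x0‖) ≤ G u := by
  obtain ⟨m, ⟨hmD, hmK⟩, hmin⟩ := aux_attain h (isCompact_closedBall x0 1)
    ⟨x0, hx0, by simp⟩
  have h0 := hmin x0 ⟨hx0, by simp⟩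
  refine ⟨G x0 - G m, by linarith, ?_⟩
  intro u hu
  by_cases hr : ‖u - x0‖ ≤ 1
  · have := hmin u ⟨hu, by simpa [dist_eq_norm] using hr⟩
    nlinarith [norm_nonneg (u - x0)]
  · push Not at hr
    set r := ‖u - x0‖ with hrdef
    have hr0 : 0 < r := by linarith
    have hinv : 0 ≤ 1 / r := by positivity
    have hinv1 : 1 / r ≤ 1 := by rw [div_le_one hr0]; exact hr.le
    have hq := hG.2 hx0 hu (sub_nonneg.2 hinv1) hinv (by ring)
    have hqD := hG.1 hx0 hu (sub_nonneg.2 hinv1) hinv (by ring)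
    have heq : ‖((1 - 1 / r) • x0 + (1 / r) • u) - x0‖ = 1 := by
      have : ((1 - 1 / r) • x0 + (1 / r) • u) - x0 = (1 / r) • (u - x0) := by
        module
      rw [this, norm_smul, ← hrdef, Real.norm_of_nonneg hinv]
      field_simp
    have h2 := hmin _ ⟨hqD, by rw [Metric.mem_closedBall, dist_eq_norm, heq]⟩
    have h3 := h2.trans hq
    simp only [smul_eq_mul] at h3
    have h4 : r * G m ≤ (r - 1) * G x0 + G u := by
      have := mul_le_mul_of_nonneg_left h3 hr0.le
      have e : r * ((1 - 1 / r) * G x0 + 1 / r * G u) = (r - 1) * G x0 + G u := by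
        field_simp
      linarith
    nlinarith

lemma aux_prox {D : Set E} {G : E → ℝ} (h : AuxEpi D G) (hG : ConvexOn ℝ D G)
    (hne : D.Nonempty) {c : ℝ} (hc : 0 < c) (a : E) :
    ∃ x ∈ D, ∀ u ∈ D, G x + c * ‖x - a‖ ^ 2 ≤ G u + c * ‖u - a‖ ^ 2 := by
  obtain ⟨x0, hx0⟩ := hne
  obtain ⟨C, hC, hlow⟩ := aux_lower h hG hx0
  set d := ‖x0 - a‖ with hd
  have hd0 : 0 ≤ d := norm_nonneg _
  set R := 1 + 2 * d + 2 * C / c with hR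
  have hRnn : 0 ≤ R := by positivity
  have hepi : AuxEpi D (fun x => G x + c * ‖x - a‖ ^ 2) := auxEpi_add h (by fun_prop)
  obtain ⟨x, ⟨hxD, hxK⟩, hmin⟩ := aux_attain hepi (isCompact_closedBall x0 R)
    ⟨x0, hx0, by simpa using hRnn⟩
  refine ⟨x, hxD, fun u hu => ?_⟩
  by_cases hr : ‖u - x0‖ ≤ R
  · exact hmin u ⟨hu, by simpa [dist_eq_norm] using hr⟩
  · push Not at hr
    have h1 := hmin x0 ⟨hx0, by simpa using hRnn⟩
    simp only [← hd] at h1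
    have h2 := hlow u hu
    set r := ‖u - x0‖
    have h3 : r - d ≤ ‖u - a‖ := by
      have : ‖u - x0‖ ≤ ‖u - a‖ + ‖a - x0‖ := norm_sub_le_norm_sub_add_norm_sub _ _ _
      rw [norm_sub_rev a x0] at this
      linarith
    have hCc : 0 ≤ 2 * C / c := by positivity
    have h4 : (r - d) ^ 2 ≤ ‖u - a‖ ^ 2 := by
      apply pow_le_pow_left₀ _ h3
      linarith
    have hr1 : 1 ≤ r := by linarith
    have h5 : c * (r * R) ≤ c * (r * r) := by gcongr
    have h6 : c * (r * R) = c * r + 2 * c * d * r + 2 * C * r := by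
      rw [hR]; field_simp
    have h7 : c * (r - d) ^ 2 ≤ c * ‖u - a‖ ^ 2 := by gcongr
    have h8 : C ≤ C * r := by nlinarith
    have h9 : 0 ≤ c * r := by positivity
    nlinarith

/-- Resolvent with a parameter. -/
lemma aux_resolvent {D : Set E} {G : E → ℝ} (h : AuxEpi D G) (hG : ConvexOn ℝ D G)
    (hne : D.Nonempty) {c : ℝ} (hc : 0 < c) (a : E) :
    ∃ x ∈ D, (∀ u ∈ D, G x + c * ‖x - a‖ ^ 2 ≤ G u + c * ‖u - a‖ ^ 2) ∧
      ∀ u ∈ D, G x + ⟪(2 * c) • (a - x), u - x⟫ ≤ G u := by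
  obtain ⟨x, hxD, hx⟩ := aux_prox h hG hne hc a
  refine ⟨x, hxD, hx, aux_frechet hG hxD c ?_⟩
  intro u hu _
  have h1 := hx u hu
  have e : u - a = (u - x) + (x - a) := by abel
  rw [e, norm_add_sq_real] at h1
  rw [inner_smul_left, ← neg_sub x a, inner_neg_left, real_inner_comm]
  simp only [conj_trivial]
  nlinarith

/-- Strong monotonicity gives the strong subgradient inequality. -/
lemma aux_strong_sub {D : Set E} {G : E → ℝ} (h : AuxEpi D G) (hG : ConvexOn ℝ D G) {μ : ℝ}
    (hμ : 0 ≤ μ)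
    (hmon : ∀ x ∈ D, ∀ x' ∈ D, ∀ v v' : E, (∀ u ∈ D, G x + ⟪v, u - x⟫ ≤ G u) →
      (∀ u ∈ D, G x' + ⟪v', u - x'⟫ ≤ G u) → μ * ‖x - x'‖ ^ 2 ≤ ⟪v - v', x - x'⟫)
    {x v : E} (hx : x ∈ D) (hv : ∀ u ∈ D, G x + ⟪v, u - x⟫ ≤ G u) :
    ∀ u ∈ D, G x + ⟪v, u - x⟫ + μ / 2 * ‖u - x‖ ^ 2 ≤ G u := by
  intro u hu
  have main : ∀ γ : ℝ, 0 < γ →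
      G x + ⟪v, u - x⟫ + μ / 2 * ‖u - x‖ ^ 2 - γ * (‖u - x‖ ^ 2) ^ 2 ≤ G u := by
    intro γ hγ
    set p : E → ℝ := fun y => - ⟪v, y - x⟫ - μ / 2 * ‖y - x‖ ^ 2 + γ * (‖y - x‖ ^ 2) ^ 2 with hp
    have hepi : AuxEpi D (fun y => G y + p y) := auxEpi_add h (by fun_prop)
    set R := Real.sqrt (μ / 2 / γ) with hR
    have hRnn : 0 ≤ R := Real.sqrt_nonneg _
    have hR2 : γ * R ^ 2 = μ / 2 := by
      rw [hR, Real.sq_sqrt (by positivity)]; field_simp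
    obtain ⟨w, ⟨hwD, hwK⟩, hmin⟩ := aux_attain hepi (isCompact_closedBall x R)
      ⟨x, hx, by simpa using hRnn⟩
    have hpx : p x = 0 := by simp [hp]
    have hmin' : ∀ y ∈ D, G w + p w ≤ G y + p y := by
      intro y hy
      by_cases hr : ‖y - x‖ ≤ R
      · exact hmin y ⟨hy, by simpa [dist_eq_norm] using hr⟩
      · push Not at hr
        have h1 := hmin x ⟨hx, by simpa using hRnn⟩
        simp only [hpx] at h1
        have h2 := hv y hy
        have h3 : R ^ 2 ≤ ‖y - x‖ ^ 2 := by gcongr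
        have h4 : γ * R ^ 2 * ‖y - x‖ ^ 2 ≤ γ * ‖y - x‖ ^ 2 * ‖y - x‖ ^ 2 := by gcongr
        rw [hR2] at h4
        have h5 : p y = - ⟪v, y - x⟫ - μ / 2 * ‖y - x‖ ^ 2 + γ * (‖y - x‖ ^ 2) ^ 2 := rfl
        nlinarith
    set b := w - x with hb
    set A := ‖b‖ ^ 2 with hA
    -- subgradient at w
    have hsub := aux_frechet hG hwD (x := w) (s := v + (μ - 4 * γ * A) • b)
      (γ * (2 * A + (2 * ‖b‖ + 1) ^ 2)) (by
        intro y hy hy1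
        have h1 := hmin' y hy
        set e := y - w with he
        have e1 : y - x = b + e := by rw [hb, he]; abel
        simp only [hp, e1, ← hb, norm_add_sq_real, inner_add_right, ← hA] at h1
        rw [inner_add_left, inner_smul_left]
        simp only [conj_trivial]
        have hie : |⟪b, e⟫| ≤ ‖b‖ * ‖e‖ := abs_real_inner_le_norm b e
        set i := ⟪b, e⟫
        have hδ : |2 * i + ‖e‖ ^ 2| ≤ (2 * ‖b‖ + 1) * ‖e‖ := by
          have : ‖e‖ ^ 2 ≤ ‖e‖ := by nlinarith [norm_nonneg e]
          calc |2 * i + ‖e‖ ^ 2| ≤ |2 * i| + |‖e‖ ^ 2| := abs_add_le _ _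
            _ ≤ 2 * (‖b‖ * ‖e‖) + ‖e‖ := by
                rw [abs_mul, abs_two, abs_of_nonneg (sq_nonneg ‖e‖)]
                gcongr
            _ = _ := by ring
        have hδ2 : (2 * i + ‖e‖ ^ 2) ^ 2 ≤ ((2 * ‖b‖ + 1) * ‖e‖) ^ 2 := by
          rw [← sq_abs]
          gcongr
        have hδ3 := mul_le_mul_of_nonneg_left hδ2 hγ.le
        have hme : 0 ≤ μ / 2 * ‖e‖ ^ 2 := by positivity
        nlinarith)
    have h2 := hmon w hwD x hx _ _ hsub hv
    rw [add_sub_cancel_left, ← hb, inner_smul_left, real_inner_self_eq_norm_sq, ← hA] at h2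
    simp only [conj_trivial] at h2
    have hA0 : A = 0 := by
      have h3 : γ * A ^ 2 ≤ 0 := by nlinarith
      have h4 : A ^ 2 ≤ 0 := by
        by_contra hcon
        push Not at hcon
        nlinarith
      nlinarith [sq_nonneg A, pow_eq_zero_iff (two_ne_zero) |>.1 (le_antisymm h4 (sq_nonneg A))]
    have hwx : w = x := by
      have : ‖b‖ = 0 := by simpa [hA] using hA0
      rw [norm_eq_zero] at this
      exact sub_eq_zero.1 this
    have h5 := hmin' u hu
    rw [hwx, hpx] at h5
    simp only [hp] at h5
    linarith
  have hlim : Tendsto (fun γ : ℝ => G x + ⟪v, u - x⟫ + μ / 2 * ‖u - x‖ ^ 2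
      - γ * (‖u - x‖ ^ 2) ^ 2) (𝓝[>] 0)
      (𝓝 (G x + ⟪v, u - x⟫ + μ / 2 * ‖u - x‖ ^ 2 - 0 * (‖u - x‖ ^ 2) ^ 2)) :=
    (Continuous.tendsto (by fun_prop) 0).mono_left nhdsWithin_le_nhds
  have := le_of_tendsto hlim (by
    filter_upwards [self_mem_nhdsWithin] with γ hγ using main γ hγ)
  simpa using this

/-- Strong monotonicity gives strong convexity. -/
lemma aux_strong_convex {D : Set E} {G : E → ℝ} (h : AuxEpi D G) (hG : ConvexOn ℝ D G) {μ : ℝ}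
    (hμ : 0 ≤ μ)
    (hmon : ∀ x ∈ D, ∀ x' ∈ D, ∀ v v' : E, (∀ u ∈ D, G x + ⟪v, u - x⟫ ≤ G u) →
      (∀ u ∈ D, G x' + ⟪v', u - x'⟫ ≤ G u) → μ * ‖x - x'‖ ^ 2 ≤ ⟪v - v', x - x'⟫) :
    ConvexOn ℝ D (fun x => G x - μ / 2 * ‖x‖ ^ 2) := by
  refine ⟨hG.1, ?_⟩
  intro x hx y hy a b ha hb hab
  set m := a • x + b • y with hm
  have hmD : m ∈ D := hG.1 hx hy ha hb hab
  have hex : ∀ k : ℕ, ∃ q ∈ D, (∀ u ∈ D, G q + ((k : ℝ) + 1) * ‖q - m‖ ^ 2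
      ≤ G u + ((k : ℝ) + 1) * ‖u - m‖ ^ 2) ∧
      ∀ u ∈ D, G q + ⟪(2 * ((k : ℝ) + 1)) • (m - q), u - q⟫ ≤ G u :=
    fun k => aux_resolvent h hG ⟨m, hmD⟩ (by positivity) m
  choose q hqD hq1 hq2 using hex
  obtain ⟨C, hC, hlow⟩ := aux_lower h hG hmD
  have hd : ∀ k : ℕ, ((k : ℝ) + 1) * ‖q k - m‖ ^ 2 ≤ C * (1 + ‖q k - m‖) := by
    intro k
    have h1 := hq1 k m hmD
    have h2 := hlow (q k) (hqD k)
    simp at h1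
    linarith
  have hle2 : ∀ k : ℕ, ‖q k - m‖ ≤ 1 + 2 * C := by
    intro k
    by_contra hcon
    push Not at hcon
    have h1 := hd k
    have hk : (0 : ℝ) ≤ k := k.cast_nonneg
    set r := ‖q k - m‖
    have : 0 ≤ (k : ℝ) * r ^ 2 := by positivity
    nlinarith
  have hsq : Tendsto (fun k => ‖q k - m‖ ^ 2) atTop (𝓝 0) := by
    have hb' : ∀ k : ℕ, ‖q k - m‖ ^ 2 ≤ (C * (2 + 2 * C)) * (1 / ((k : ℝ) + 1)) := by
      intro k
      have h1 := hd k
      have hk : (0 : ℝ) < (k : ℝ) + 1 := by positivity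
      have h2 : C * (1 + ‖q k - m‖) ≤ C * (2 + 2 * C) := by
        have := hle2 k
        exact mul_le_mul_of_nonneg_left (by linarith) hC
      rw [mul_one_div, le_div_iff₀ hk]
      linarith
    refine squeeze_zero (fun k => sq_nonneg _) hb' ?_
    have := (tendsto_one_div_add_atTop_nhds_zero_nat (𝕜 := ℝ)).const_mul (C * (2 + 2 * C))
    simpa using this
  have hqm : Tendsto q atTop (𝓝 m) := by
    rw [tendsto_iff_norm_sub_tendsto_zero]
    have := hsq.sqrt
    simpa using this
  -- key inequality
  set B := a * (G x - μ / 2 * ‖x‖ ^ 2) + b * (G y - μ / 2 * ‖y‖ ^ 2) with hB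
  have key : ∀ k, G (q k) ≤ B + μ / 2 * ‖q k‖ ^ 2 + μ * ⟪q k, m - q k⟫ := by
    intro k
    have hs := aux_strong_sub h hG hμ hmon (hqD k) (hq2 k)
    have hx1 := hs x hx
    have hy1 := hs y hy
    set s := (2 * ((k : ℝ) + 1)) • (m - q k) with hsdef
    have hsm : 0 ≤ ⟪s, m - q k⟫ := by
      rw [hsdef, inner_smul_left, real_inner_self_eq_norm_sq]
      simp only [conj_trivial]
      positivity
    have hb1 : b = 1 - a := by linarith
    have hx2 := mul_le_mul_of_nonneg_left hx1 ha
    have hy2 := mul_le_mul_of_nonneg_left hy1 hb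
    have e1 : ⟪s, m - q k⟫ = a * ⟪s, x - q k⟫ + b * ⟪s, y - q k⟫ := by
      rw [← inner_smul_right, ← inner_smul_right, ← inner_add_right]
      congr 1
      rw [hm, hb1]; module
    have e2 : ⟪q k, m - q k⟫ = a * ⟪q k, x⟫ + b * ⟪q k, y⟫ - ‖q k‖ ^ 2 := by
      rw [inner_sub_right, hm, inner_add_right, inner_smul_right, inner_smul_right,
        real_inner_self_eq_norm_sq]
    rw [norm_sub_sq_real, real_inner_comm (q k) x] at hx2
    rw [norm_sub_sq_real, real_inner_comm (q k) y] at hy2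
    rw [hB, e2]
    rw [e1] at hsm
    subst hb1
    nlinarith
  have hmem : ∀ k, ((q k, B + μ / 2 * ‖q k‖ ^ 2 + μ * ⟪q k, m - q k⟫) : E × ℝ) ∈
      {p : E × ℝ | p.1 ∈ D ∧ G p.1 ≤ p.2} := fun k => ⟨hqD k, key k⟩
  have hlim : Tendsto (fun k => ((q k, B + μ / 2 * ‖q k‖ ^ 2 + μ * ⟪q k, m - q k⟫) : E × ℝ)) atTop
      (𝓝 (m, B + μ / 2 * ‖m‖ ^ 2 + μ * ⟪m, m - m⟫)) := by
    have hc : Continuous (fun z : E => ((z, B + μ / 2 * ‖z‖ ^ 2 + μ * ⟪z, m - z⟫) : E × ℝ)) := by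
      fun_prop
    exact (hc.tendsto m).comp hqm
  have hfin := (IsClosed.mem_of_tendsto h hlim (Eventually.of_forall hmem)).2
  simp only [sub_self, inner_zero_right, mul_zero, add_zero] at hfin
  simp only [smul_eq_mul]
  linarith

lemma aux_lip_of_ae [MeasurableSpace E] [BorelSpace E] {N : E → E} {K : NNReal}
    (hN : LipschitzWith K N) {c : ℝ} (hc : 0 ≤ c) (μ : Measure E) [μ.IsAddHaarMeasure]
    (hae : ∀ᵐ x ∂μ, ∃ P : E →L[ℝ] E, HasFDerivAt N P x ∧ ‖P‖ ≤ c) (x v : E) :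
    ‖N (x + v) - N x‖ ≤ c * ‖v‖ := by
  obtain ⟨B, hBsub, hBm, hB0⟩ := exists_measurable_superset_of_null (ae_iff.1 hae)
  have hgood : ∀ y, y ∉ B → ∃ P : E →L[ℝ] E, HasFDerivAt N P y ∧ ‖P‖ ≤ c := by
    intro y hy
    by_contra hcon
    exact hy (hBsub hcon)
  have h1 : ∀ t : ℝ, ∀ᵐ y ∂μ, y + t • v ∉ B := by
    intro t
    have : ∀ᵐ y ∂μ, y ∉ B := by
      rw [ae_iff]; simpa using hB0
    exact (measurePreserving_add_right μ (t • v)).quasiMeasurePreserving.ae this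
  have hmeas : MeasurableSet {p : ℝ × E | p.2 + p.1 • v ∉ B} := by
    have hcont : Measurable (fun p : ℝ × E => p.2 + p.1 • v) :=
      Continuous.measurable (by fun_prop)
    exact hcont hBm.compl
  have h2 : ∀ᵐ y ∂μ, ∀ᵐ t : ℝ, y + t • v ∉ B :=
    (Measure.ae_ae_comm (p := fun (t : ℝ) (y : E) => y + t • v ∉ B) hmeas).1
      (Eventually.of_forall h1)
  have h3 : ∀ᵐ y ∂μ, ‖N (y + v) - N y‖ ≤ c * ‖v‖ := by
    filter_upwards [h2] with y hy
    set q := N (y + v) - N y with hq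
    set g : ℝ → ℝ := fun t => ⟪q, N (y + t • v)⟫ with hg
    have hglip : LipschitzWith (‖q‖₊ * (K * ‖v‖₊)) g := by
      apply LipschitzWith.of_dist_le_mul
      intro s t
      rw [Real.dist_eq, hg]
      simp only
      rw [← inner_sub_right]
      refine (abs_real_inner_le_norm _ _).trans ?_
      have := hN.dist_le_mul (y + s • v) (y + t • v)
      rw [dist_eq_norm, dist_eq_norm, add_sub_add_left_eq_sub, ← sub_smul, norm_smul] at this
      rw [Real.dist_eq]
      push_cast
      calc ‖q‖ * ‖N (y + s • v) - N (y + t • v)‖ ≤ ‖q‖ * (K * (‖s - t‖ * ‖v‖)) := by gcongr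
        _ = _ := by rw [Real.norm_eq_abs]; ring
    have hac : AbsolutelyContinuousOnInterval g 0 1 :=
      (hglip.lipschitzOnWith (s := uIcc 0 1)).absolutelyContinuousOnInterval
    have hint := hac.integral_deriv_eq_sub
    have hder : ∀ᵐ t : ℝ, t ∈ uIoc (0:ℝ) 1 → ‖deriv g t‖ ≤ ‖q‖ * (c * ‖v‖) := by
      filter_upwards [hy] with t ht _
      obtain ⟨P, hP, hPc⟩ := hgood _ ht
      have hl : HasDerivAt (fun t : ℝ => y + t • v) v t := by
        have := ((hasDerivAt_id t).smul_const v).const_add y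
        simpa using this
      have h5 : HasDerivAt (fun t : ℝ => N (y + t • v)) (P v) t := hP.comp_hasDerivAt t hl
      have h6 : HasDerivAt g ⟪q, P v⟫ t := by
        have := (hasDerivAt_const t q).inner ℝ h5
        simpa using this
      rw [h6.deriv]
      refine (norm_inner_le_norm _ _).trans ?_
      gcongr
      exact (P.le_opNorm v).trans (by gcongr)
    have hle := intervalIntegral.norm_integral_le_of_norm_le_const_ae hder
    rw [hint] at hle
    have e : g 1 - g 0 = ‖q‖ ^ 2 := by
      simp only [hg, one_smul, zero_smul, add_zero]
      rw [← inner_sub_right, ← hq, real_inner_self_eq_norm_sq]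
    rw [e, Real.norm_of_nonneg (by positivity)] at hle
    simp only [sub_zero, abs_one, mul_one] at hle
    by_cases hq0 : ‖q‖ = 0
    · rw [hq0]; positivity
    · have : 0 < ‖q‖ := lt_of_le_of_ne (norm_nonneg _) (Ne.symm hq0)
      rw [sq] at hle
      exact le_of_mul_le_mul_left hle this
  have hcl : IsClosed {y | ‖N (y + v) - N y‖ ≤ c * ‖v‖} := by
    have := hN.continuous
    exact isClosed_le (by fun_prop) continuous_const
  have hd : Dense {y | ‖N (y + v) - N y‖ ≤ c * ‖v‖} := Measure.dense_of_ae h3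
  have : x ∈ closure {y | ‖N (y + v) - N y‖ ≤ c * ‖v‖} := hd x
  rwa [hcl.closure_eq] at this

end Aux

section Transfer

lemma tr_coe {φ : EuclideanSpace ℝ (Fin n) → EReal} (hnb : ∀ x, φ x ≠ ⊥)
    {x : EuclideanSpace ℝ (Fin n)} (hx : φ x ≠ ⊤) : ((φ x).toReal : EReal) = φ x :=
  EReal.coe_toReal hx (hnb x)

lemma tr_gph {φ : EuclideanSpace ℝ (Fin n) → EReal} (hnb : ∀ x, φ x ≠ ⊥) (ρ : ℝ)
    (x y : EuclideanSpace ℝ (Fin n)) :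
    (x, y) ∈ gphSubdiff ρ φ ↔ φ x ≠ ⊤ ∧ ∀ u ∈ {u | φ u ≠ ⊤},
      ((φ x).toReal + ρ / 2 * ‖x‖ ^ 2) + ⟪y + ρ • x, u - x⟫
        ≤ (φ u).toReal + ρ / 2 * ‖u‖ ^ 2 := by
  have alg : ∀ u : EuclideanSpace ℝ (Fin n), ⟪y + ρ • x, u - x⟫ + ρ / 2 * ‖x‖ ^ 2
      - ρ / 2 * ‖u‖ ^ 2 = ⟪y, u - x⟫ - ρ / 2 * ‖u - x‖ ^ 2 := by
    intro u
    rw [inner_add_left, inner_smul_left, norm_sub_sq_real, inner_sub_right x u x,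
      real_inner_self_eq_norm_sq, real_inner_comm x u]
    simp only [conj_trivial]
    ring
  constructor
  · rintro ⟨hx, h⟩
    refine ⟨hx, fun u hu => ?_⟩
    have h1 := h u
    simp only at h1 hx
    rw [← tr_coe hnb hx, ← tr_coe hnb hu, ← EReal.coe_add, EReal.coe_le_coe_iff] at h1
    linarith [alg u]
  · rintro ⟨hx, h⟩
    refine ⟨hx, fun u => ?_⟩
    by_cases hu : φ u = ⊤
    · rw [hu]; exact le_top
    · have h1 := h u hu
      simp only
      rw [← tr_coe hnb hx, ← tr_coe hnb hu, ← EReal.coe_add, EReal.coe_le_coe_iff]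
      linarith [alg u]

lemma tr_epi {φ : EuclideanSpace ℝ (Fin n) → EReal} (hnb : ∀ x, φ x ≠ ⊥)
    (hlsc : LowerSemicontinuous φ) (σ : ℝ) :
    AuxEpi {x | φ x ≠ ⊤} (fun x => (φ x).toReal + σ / 2 * ‖x‖ ^ 2) := by
  apply auxEpi_add _ (by fun_prop)
  have h1 := hlsc.isClosed_epigraph
  have hc : Continuous (fun p : EuclideanSpace ℝ (Fin n) × ℝ =>
      ((p.1, (p.2 : EReal)) : EuclideanSpace ℝ (Fin n) × EReal)) :=
    continuous_fst.prodMk (continuous_coe_real_ereal.comp continuous_snd)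
  have h2 := h1.preimage hc
  unfold AuxEpi
  convert h2 using 1
  ext p
  simp only [mem_ofPred_eq, mem_preimage]
  constructor
  · rintro ⟨ha, hb⟩
    rw [← tr_coe hnb ha]
    exact_mod_cast hb
  · intro hb
    have ha : φ p.1 ≠ ⊤ := fun h => by rw [h] at hb; simp at hb
    refine ⟨ha, ?_⟩
    rw [← tr_coe hnb ha] at hb
    exact_mod_cast hb

lemma tr_convex {φ : EuclideanSpace ℝ (Fin n) → EReal} (hnb : ∀ x, φ x ≠ ⊥) (σ : ℝ) :
    ERealConvex (shiftFun σ φ) ↔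
      ConvexOn ℝ {x | φ x ≠ ⊤} (fun x => (φ x).toReal + σ / 2 * ‖x‖ ^ 2) := by
  have hs : ∀ x, φ x ≠ ⊤ → shiftFun σ φ x = (((φ x).toReal + σ / 2 * ‖x‖ ^ 2 : ℝ) : EReal) := by
    intro x hx
    rw [EReal.coe_add, tr_coe hnb hx]; rfl
  have hst : ∀ x, φ x = ⊤ → shiftFun σ φ x = ⊤ := by
    intro x hx
    rw [shiftFun, hx, EReal.top_add_coe]
  have hsb : ∀ x, shiftFun σ φ x ≠ ⊥ := by
    intro x
    by_cases hx : φ x = ⊤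
    · rw [hst x hx]; simp
    · rw [hs x hx]; exact EReal.coe_ne_bot _
  have hmb : ∀ (a : ℝ) x, 0 ≤ a → (a : EReal) * shiftFun σ φ x ≠ ⊥ := by
    intro a x ha
    by_cases hx : φ x = ⊤
    · rw [hst x hx]
      rcases ha.eq_or_lt with rfl | ha
      · simp
      · rw [EReal.coe_mul_top_of_pos ha]; simp
    · rw [hs x hx, ← EReal.coe_mul]; exact EReal.coe_ne_bot _
  constructor
  · intro h
    have key : ∀ x y : EuclideanSpace ℝ (Fin n), φ x ≠ ⊤ → φ y ≠ ⊤ → ∀ a b : ℝ, 0 ≤ a → 0 ≤ b →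
        a + b = 1 → shiftFun σ φ (a • x + b • y) ≤
        ((a * ((φ x).toReal + σ / 2 * ‖x‖ ^ 2) + b * ((φ y).toReal + σ / 2 * ‖y‖ ^ 2) : ℝ)
          : EReal) := by
      intro x y hx hy a b ha hb hab
      have := h x y a b ha hb hab
      rw [hs x hx, hs y hy, ← EReal.coe_mul, ← EReal.coe_mul, ← EReal.coe_add] at this
      exact this
    have hD : ∀ x y : EuclideanSpace ℝ (Fin n), φ x ≠ ⊤ → φ y ≠ ⊤ → ∀ a b : ℝ, 0 ≤ a → 0 ≤ b →
        a + b = 1 → φ (a • x + b • y) ≠ ⊤ := by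
      intro x y hx hy a b ha hb hab hcon
      have := key x y hx hy a b ha hb hab
      rw [hst _ hcon, top_le_iff] at this
      exact EReal.coe_ne_top _ this
    refine ⟨fun x hx y hy a b ha hb hab => hD x y hx hy a b ha hb hab, ?_⟩
    intro x hx y hy a b ha hb hab
    have := key x y hx hy a b ha hb hab
    rw [hs _ (hD x y hx hy a b ha hb hab), EReal.coe_le_coe_iff] at this
    exact this
  · intro h x y a b ha hb hab
    rcases ha.eq_or_lt with rfl | ha'
    · have : b = 1 := by linarith
      subst this
      simp
    rcases hb.eq_or_lt with rfl | hb'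
    · have : a = 1 := by linarith
      subst this
      simp
    by_cases hx : φ x = ⊤
    · rw [hst x hx, EReal.coe_mul_top_of_pos ha', EReal.top_add_of_ne_bot (hmb b y hb)]
      exact le_top
    by_cases hy : φ y = ⊤
    · rw [hst y hy, EReal.coe_mul_top_of_pos hb', EReal.add_top_of_ne_bot (hmb a x ha)]
      exact le_top
    rw [hs x hx, hs y hy, hs _ (h.1 hx hy ha hb hab), ← EReal.coe_mul, ← EReal.coe_mul,
      ← EReal.coe_add, EReal.coe_le_coe_iff]
    exact h.2 hx hy ha hb hab

end Transfer

section Main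

variable {E : Type*} [NormedAddCommGroup E] [InnerProductSpace ℝ E]

/-- `v` is a convex subgradient of `G` on `D` at `x`. -/
def AuxSub (D : Set E) (G : E → ℝ) (x v : E) : Prop :=
  x ∈ D ∧ ∀ u ∈ D, G x + ⟪v, u - x⟫ ≤ G u

lemma auxSub_mono {D : Set E} {G : E → ℝ} {x x' v v' : E} (h : AuxSub D G x v)
    (h' : AuxSub D G x' v') : 0 ≤ ⟪v' - v, x' - x⟫ := by
  have h1 := h.2 x' h'.1
  have h2 := h'.2 x h.1
  rw [← neg_sub x' x, inner_neg_right] at h2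
  rw [inner_sub_left]
  linarith

lemma aux_exists_J [FiniteDimensional ℝ E] {D : Set E} {G : E → ℝ} (h : AuxEpi D G)
    (hG : ConvexOn ℝ D G) (hne : D.Nonempty) : ∃ J : E → E, ∀ u, AuxSub D G (J u) (u - J u) := by
  have : ∀ u, ∃ x, AuxSub D G x (u - x) := by
    intro u
    obtain ⟨x, hx, -, h2⟩ := aux_resolvent h hG hne (c := 1 / 2) (by norm_num) u
    refine ⟨x, hx, ?_⟩
    simpa using h2
  choose J hJ using this
  exact ⟨J, hJ⟩

lemma aux_J_eq {D : Set E} {G : E → ℝ} {J : E → E} (hJ : ∀ u, AuxSub D G (J u) (u - J u))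
    {x v : E} (h : AuxSub D G x v) : J (x + v) = x := by
  have h1 := auxSub_mono h (hJ (x + v))
  have e : x + v - J (x + v) - v = -(J (x + v) - x) := by abel
  rw [e, inner_neg_left, real_inner_self_eq_norm_sq] at h1
  have : ‖J (x + v) - x‖ = 0 := by
    have := sq_nonneg ‖J (x + v) - x‖
    exact pow_eq_zero_iff (two_ne_zero) |>.1 (by linarith)
  exact sub_eq_zero.1 (norm_eq_zero.1 this)

lemma aux_J_lip {D : Set E} {G : E → ℝ} {J : E → E} (hJ : ∀ u, AuxSub D G (J u) (u - J u)) :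
    LipschitzWith 1 J := by
  apply LipschitzWith.of_dist_le_mul
  intro u u'
  have h1 := auxSub_mono (hJ u') (hJ u)
  have e : u - J u - (u' - J u') = (u - u') - (J u - J u') := by abel
  rw [e, inner_sub_left, real_inner_self_eq_norm_sq] at h1
  have h2 := real_inner_le_norm (u - u') (J u - J u')
  rw [dist_eq_norm, dist_eq_norm]
  simp only [NNReal.coe_one, one_mul]
  by_contra hcon
  push Not at hcon
  nlinarith [norm_nonneg (u - u'), norm_nonneg (J u - J u')]

lemma main_forward (φ : EuclideanSpace ℝ (Fin n) → EReal)
    (hnb : ∀ x, φ x ≠ ⊥) (hproper : ∃ x, φ x ≠ ⊤)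
    (hlsc : LowerSemicontinuous φ) (κ : ℝ) (hκ : 0 < κ)
    (hconv : ERealConvex (shiftFun (-κ) φ)) :
    ERealConvex (shiftFun 0 φ) ∧
        ∀ x y : EuclideanSpace ℝ (Fin n), (x, y) ∈ gphSubdiff 0 φ →
          ∀ w z : EuclideanSpace ℝ (Fin n),
            (z, -w) ∈ regNormalCone (gphSubdiff 0 φ) (x, y) →
            κ * ‖w‖ ^ 2 ≤ ⟪z, w⟫ := by
  rw [tr_convex hnb] at hconv ⊢
  have hepi := tr_epi hnb hlsc (-κ)
  set D := {x | φ x ≠ ⊤} with hD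
  set f : EuclideanSpace ℝ (Fin n) → ℝ := fun x => (φ x).toReal + -κ / 2 * ‖x‖ ^ 2 with hf
  have hne : D.Nonempty := hproper
  have hquad : ConvexOn ℝ D (fun x : EuclideanSpace ℝ (Fin n) => κ / 2 * ‖x‖ ^ 2) := by
    refine ⟨hconv.1, ?_⟩
    intro x _ y _ a b ha hb hab
    simp only [smul_eq_mul]
    have hb1 : b = 1 - a := by linarith
    rw [norm_add_sq_real, norm_smul, norm_smul, inner_smul_left, inner_smul_right,
      Real.norm_of_nonneg ha, Real.norm_of_nonneg hb]
    simp only [conj_trivial]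
    have h1 : 0 ≤ a * b * ‖x - y‖ ^ 2 := by positivity
    rw [norm_sub_sq_real] at h1
    subst hb1
    have h2 := mul_nonneg hκ.le h1
    nlinarith
  constructor
  · have := hconv.add hquad
    refine this.congr fun x _ => ?_
    simp [hf]
    ring
  intro x y hxy w z hzw
  obtain ⟨J, hJ⟩ := aux_exists_J hepi hconv hne
  -- strong subgradients of φ
  have hto : ∀ X S, AuxSub D f X S → (X, S + κ • X) ∈ gphSubdiff 0 φ := by
    intro X S hXS
    rw [tr_gph hnb]
    refine ⟨hXS.1, fun u hu => ?_⟩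
    have h1 := hXS.2 u hu
    simp only [hf] at h1
    have h2 : 0 ≤ κ / 2 * ‖u - X‖ ^ 2 := by positivity
    rw [norm_sub_sq_real] at h2
    have h3 : ⟪κ • X, u - X⟫ = κ * (⟪u, X⟫ - ‖X‖ ^ 2) := by
      rw [inner_smul_left, inner_sub_right, real_inner_self_eq_norm_sq, real_inner_comm]
      simp
    simp only [zero_smul, add_zero]
    rw [inner_add_left, h3]
    linarith
  have hfrom : AuxSub D f x (y - κ • x) := by
    rw [tr_gph hnb] at hxy
    refine ⟨hxy.1, aux_frechet hconv hxy.1 (κ / 2) ?_⟩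
    intro u hu _
    have h1 := hxy.2 u hu
    simp only [zero_smul, add_zero] at h1
    simp only [hf]
    have h3 : ⟪κ • x, u - x⟫ = κ * (⟪u, x⟫ - ‖x‖ ^ 2) := by
      rw [inner_smul_left, inner_sub_right, real_inner_self_eq_norm_sq, real_inner_comm]
      simp
    rw [inner_sub_left, h3, norm_sub_sq_real]
    linarith
  set s := y - κ • x with hs
  set q := z - κ • w + w with hq
  set d := q - (2 : ℝ) • w with hd
  have key : ∀ ε > (0 : ℝ), ‖d‖ ^ 2 - ‖q‖ * ‖d‖ ≤ 2 * (1 + κ) * ‖d‖ * ε := by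
    intro ε hε
    obtain ⟨δ, hδ, hN⟩ := hzw ε hε
    set t := δ / (2 * (1 + κ) * (‖d‖ + 1)) with ht
    have ht0 : 0 < t := by positivity
    set u := x + s + t • d with hu
    have hX := hJ u
    set X := J u with hXdef
    have hmono := auxSub_mono hfrom hX
    set a := X - x with ha
    set b := u - X - s with hb
    have hab : a + b = t • d := by rw [ha, hb, hu]; abel
    have hnab : ‖a + b‖ = t * ‖d‖ := by rw [hab, norm_smul, Real.norm_of_nonneg ht0.le]
    have hadd := norm_add_sq_real a b
    have hsub := norm_sub_sq_real a b
    rw [real_inner_comm] at hmono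
    have hna : ‖a‖ ≤ t * ‖d‖ := by
      rw [← hnab]
      apply le_of_sq_le_sq _ (norm_nonneg _)
      nlinarith [sq_nonneg ‖b‖]
    have hnb' : ‖b‖ ≤ t * ‖d‖ := by
      rw [← hnab]
      apply le_of_sq_le_sq _ (norm_nonneg _)
      nlinarith [sq_nonneg ‖a‖]
    have hnd : ‖a - b‖ ≤ t * ‖d‖ := by
      rw [← hnab]
      apply le_of_sq_le_sq _ (norm_nonneg _)
      nlinarith
    have hmem := hto _ _ hX
    have hdiff : ((X, u - X + κ • X) : EuclideanSpace ℝ (Fin n) × EuclideanSpace ℝ (Fin n))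
        - (x, y) = (a, b + κ • a) := by
      rw [Prod.mk_sub_mk, ha, hb, hs]
      congr 1
      module
    have hnorm : ‖((a, b + κ • a) : EuclideanSpace ℝ (Fin n) × EuclideanSpace ℝ (Fin n))‖
        ≤ (1 + κ) * (t * ‖d‖) := by
      rw [Prod.norm_def]
      have h0 : 0 ≤ t * ‖d‖ := by positivity
      apply max_le
      · simp only
        nlinarith
      · simp only
        calc ‖b + κ • a‖ ≤ ‖b‖ + ‖κ • a‖ := norm_add_le _ _
          _ = ‖b‖ + κ * ‖a‖ := by rw [norm_smul, Real.norm_of_nonneg hκ.le]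
          _ ≤ t * ‖d‖ + κ * (t * ‖d‖) := by gcongr
          _ = _ := by ring
    have hlt : (1 + κ) * (t * ‖d‖) < δ := by
      have e : (1 + κ) * (t * (‖d‖ + 1)) = δ / 2 := by
        rw [ht]; field_simp
      have : (1 + κ) * (t * ‖d‖) ≤ (1 + κ) * (t * (‖d‖ + 1)) := by gcongr; linarith
      linarith
    have h1 := hN _ hmem (by rw [hdiff]; exact hnorm.trans_lt hlt)
    rw [hdiff] at h1
    have h2 : pairInner (z, -w) (a, b + κ • a) ≤ ε * ((1 + κ) * (t * ‖d‖)) :=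
      h1.trans (by gcongr)
    have h3 : pairInner (z, -w) (a, b + κ • a) = ⟪q, a⟫ - t * ⟪w, d⟫ := by
      rw [← inner_smul_right, ← hab, hq]
      simp only [pairInner, inner_add_left, inner_sub_left, inner_smul_left, inner_add_right,
        inner_smul_right, inner_neg_left, conj_trivial]
      ring
    have h4 : -(‖q‖ * (t * ‖d‖)) ≤ ⟪q, a - b⟫ := by
      have := abs_real_inner_le_norm q (a - b)
      have h5 : ‖q‖ * ‖a - b‖ ≤ ‖q‖ * (t * ‖d‖) := by gcongr
      have := neg_abs_le ⟪q, a - b⟫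
      linarith
    have h5 : ⟪q, a - b⟫ = 2 * ⟪q, a⟫ - t * ⟪q, d⟫ := by
      rw [← inner_smul_right q d t, ← hab, inner_add_right, inner_sub_right]
      ring
    have h6 : ‖d‖ ^ 2 = ⟪q, d⟫ - 2 * ⟪w, d⟫ := by
      rw [← real_inner_self_eq_norm_sq]
      conv_lhs => rw [hd]
      rw [← hd, inner_sub_left, inner_smul_left]
      simp
    have h7 : t * (‖d‖ ^ 2 - ‖q‖ * ‖d‖) ≤ t * (2 * (1 + κ) * ‖d‖ * ε) := by
      rw [h6]
      nlinarith
    exact le_of_mul_le_mul_left h7 ht0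
  have key2 : ‖d‖ ^ 2 - ‖q‖ * ‖d‖ ≤ 0 := by
    have hlim : Tendsto (fun ε : ℝ => 2 * (1 + κ) * ‖d‖ * ε) (𝓝[>] 0)
        (𝓝 (2 * (1 + κ) * ‖d‖ * 0)) :=
      (Continuous.tendsto (by fun_prop) 0).mono_left nhdsWithin_le_nhds
    have := ge_of_tendsto hlim (by
      filter_upwards [self_mem_nhdsWithin] with ε hε using key ε hε)
    simpa using this
  have key3 : ‖d‖ ^ 2 ≤ ‖q‖ ^ 2 := by
    nlinarith [norm_nonneg d, norm_nonneg q, sq_nonneg (‖d‖ - ‖q‖)]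
  rw [hd, norm_sub_sq_real, inner_smul_right, norm_smul, Real.norm_of_nonneg zero_le_two, hq,
    inner_add_left, inner_sub_left, inner_smul_left, real_inner_self_eq_norm_sq] at key3
  simp only [conj_trivial] at key3
  nlinarith

lemma main_backward (φ : EuclideanSpace ℝ (Fin n) → EReal)
    (hnb : ∀ x, φ x ≠ ⊥) (hproper : ∃ x, φ x ≠ ⊤)
    (hlsc : LowerSemicontinuous φ) (κ : ℝ) (hκ : 0 < κ) (ρ : ℝ) (hρ : 0 ≤ ρ)
    (hconv : ERealConvex (shiftFun ρ φ))
    (H : ∀ x y : EuclideanSpace ℝ (Fin n), (x, y) ∈ gphSubdiff ρ φ →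
          ∀ w z : EuclideanSpace ℝ (Fin n),
            (z, -w) ∈ regNormalCone (gphSubdiff ρ φ) (x, y) →
            κ * ‖w‖ ^ 2 ≤ ⟪z, w⟫) :
    ERealConvex (shiftFun (-κ) φ) := by
  rw [tr_convex hnb] at hconv ⊢
  have hepi := tr_epi hnb hlsc ρ
  have hgph := tr_gph hnb ρ
  set D := {x | φ x ≠ ⊤} with hD
  set G : EuclideanSpace ℝ (Fin n) → ℝ := fun x => (φ x).toReal + ρ / 2 * ‖x‖ ^ 2 with hG
  have hgph' : ∀ x y, (x, y) ∈ gphSubdiff ρ φ ↔ AuxSub D G x (y + ρ • x) := fun x y => hgph x y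
  have hne : D.Nonempty := hproper
  obtain ⟨J, hJ⟩ := aux_exists_J hepi hconv hne
  have hlip := aux_J_lip hJ
  set c := 1 / (1 + ρ + κ) with hc
  have hc0 : 0 < c := by positivity
  have hc1 : c * (1 + ρ + κ) = 1 := by rw [hc]; field_simp
  -- derivative estimate
  have hder : ∀ u (P : EuclideanSpace ℝ (Fin n) →L[ℝ] EuclideanSpace ℝ (Fin n)),
      HasFDerivAt J P u → ‖P - (c / 2) • ContinuousLinearMap.id ℝ _‖ ≤ c / 2 := by
    intro u P hP
    have hq : ∀ q, ‖ContinuousLinearMap.adjoint P q - (c / 2) • q‖ ≤ c / 2 * ‖q‖ := by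
      intro q
      set w := ContinuousLinearMap.adjoint P q with hw
      set x := J u with hx
      set y := u - x - ρ • x with hy
      have hxy : (x, y) ∈ gphSubdiff ρ φ := by
        rw [hgph']
        simpa [hy] using hJ u
      have h1 := H x y hxy w (q - (1 + ρ) • w) (by
        intro ε hε
        set ε' := ε / ((‖q‖ + 1) * (2 + ρ)) with hε'
        have hε'0 : 0 < ε' := by positivity
        have hlo := hP.isLittleO.def hε'0
        rw [Metric.eventually_nhds_iff] at hlo
        obtain ⟨δ, hδ, hlo⟩ := hlo
        refine ⟨δ / (2 + ρ), by positivity, ?_⟩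
        rintro ⟨x', y'⟩ hx'y' hclose
        rw [hgph'] at hx'y'
        have hJu' := aux_J_eq hJ hx'y'
        set u' := x' + (y' + ρ • x') with hu'
        set p := ((x', y') : EuclideanSpace ℝ (Fin n) × EuclideanSpace ℝ (Fin n)) - (x, y) with hp
        have hp1 : p.1 = x' - x := rfl
        have hp2 : p.2 = y' - y := rfl
        have hdu : u' - u = (1 + ρ) • p.1 + p.2 := by
          rw [hp1, hp2, hu', hy]; module
        have hn1 : ‖p.1‖ ≤ ‖p‖ := norm_fst_le p
        have hn2 : ‖p.2‖ ≤ ‖p‖ := norm_snd_le p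
        have hdun : ‖u' - u‖ ≤ (2 + ρ) * ‖p‖ := by
          rw [hdu]
          calc ‖(1 + ρ) • p.1 + p.2‖ ≤ ‖(1 + ρ) • p.1‖ + ‖p.2‖ := norm_add_le _ _
            _ = (1 + ρ) * ‖p.1‖ + ‖p.2‖ := by
              rw [norm_smul, Real.norm_of_nonneg (by positivity)]
            _ ≤ (1 + ρ) * ‖p‖ + ‖p‖ := by gcongr
            _ = _ := by ring
        have hd2 : dist u' u < δ := by
          rw [dist_eq_norm]
          refine hdun.trans_lt ?_
          rw [lt_div_iff₀ (by positivity)] at hclose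
          linarith
        have h2 := hlo hd2
        rw [hJu', ← hx, ← hp1] at h2
        have h3 : pairInner (q - (1 + ρ) • w, -w) p = ⟪q, p.1 - P (u' - u)⟫ := by
          rw [inner_sub_right, ← ContinuousLinearMap.adjoint_inner_left, ← hw, hdu]
          simp only [pairInner, inner_sub_left, inner_smul_left, inner_add_right,
            inner_smul_right, inner_neg_left, conj_trivial]
          ring
        rw [h3]
        calc ⟪q, p.1 - P (u' - u)⟫ ≤ ‖q‖ * ‖p.1 - P (u' - u)‖ := real_inner_le_norm _ _
          _ ≤ (‖q‖ + 1) * (ε' * ((2 + ρ) * ‖p‖)) := by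
            gcongr
            · linarith
            · exact h2.trans (by gcongr)
          _ = ε * ‖p‖ := by rw [hε']; field_simp)
      rw [inner_sub_left, inner_smul_left, real_inner_self_eq_norm_sq] at h1
      simp only [conj_trivial] at h1
      have h4 : ‖w‖ ^ 2 ≤ c * ⟪q, w⟫ := by
        have h5 : (1 + ρ + κ) * ‖w‖ ^ 2 ≤ ⟪q, w⟫ := by linarith
        have h6 := mul_le_mul_of_nonneg_left h5 hc0.le
        rw [← mul_assoc, hc1, one_mul] at h6
        exact h6
      apply le_of_sq_le_sq _ (by positivity)
      rw [norm_sub_sq_real, inner_smul_right, norm_smul, Real.norm_of_nonneg (by positivity),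
        real_inner_comm]
      nlinarith
    refine ContinuousLinearMap.opNorm_le_bound _ (by positivity) ?_
    intro h
    set T := (P - (c / 2) • ContinuousLinearMap.id ℝ (EuclideanSpace ℝ (Fin n))) h with hT
    have hTe : T = P h - (c / 2) • h := by simp [hT]
    have h1 : ‖T‖ ^ 2 = ⟪ContinuousLinearMap.adjoint P T - (c / 2) • T, h⟫ := by
      have h0 : ⟪T, T⟫ = ⟪T, P h - (c / 2) • h⟫ := congrArg (fun r => ⟪T, r⟫) hTe
      rw [inner_sub_left, ContinuousLinearMap.adjoint_inner_left, inner_smul_left,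
        ← real_inner_self_eq_norm_sq, h0, inner_sub_right, inner_smul_right]
      simp only [conj_trivial]
    have h2 := real_inner_le_norm (ContinuousLinearMap.adjoint P T - (c / 2) • T) h
    have h3 : ‖ContinuousLinearMap.adjoint P T - (c / 2) • T‖ * ‖h‖ ≤ c / 2 * ‖T‖ * ‖h‖ := by
      gcongr
      exact hq T
    by_contra hcon
    push Not at hcon
    have hT0 : 0 < ‖T‖ := lt_of_le_of_lt (by positivity) hcon
    nlinarith
  have hNlip : ∃ K, LipschitzWith K (fun u => J u - (c / 2) • u) :=
    ⟨_, hlip.sub (lipschitzWith_smul (c / 2))⟩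
  obtain ⟨K, hK⟩ := hNlip
  have hN := aux_lip_of_ae hK (c := c / 2) (by positivity) volume (by
    filter_upwards [hlip.ae_differentiableAt (μ := volume)] with u hu
    refine ⟨fderiv ℝ J u - (c / 2) • ContinuousLinearMap.id ℝ _, ?_, hder u _ hu.hasFDerivAt⟩
    exact hu.hasFDerivAt.sub ((hasFDerivAt_id u).const_smul (c / 2)))
  have hstrong := aux_strong_convex hepi hconv (μ := ρ + κ) (by positivity) (by
    intro x hx x' hx' v v' hv hv'
    have e1 : J (x + v) = x := aux_J_eq hJ ⟨hx, hv⟩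
    have e2 : J (x' + v') = x' := aux_J_eq hJ ⟨hx', hv'⟩
    have h1 := hN (x' + v') ((x + v) - (x' + v'))
    rw [add_sub_cancel, e1, e2] at h1
    set a := x - x' with ha
    set b := v - v' with hb
    have e3 : x + v - (x' + v') = a + b := by rw [ha, hb]; abel
    have e4 : x - (c / 2) • (x + v) - (x' - (c / 2) • (x' + v')) = a - (c / 2) • (a + b) := by
      rw [ha, hb]; module
    rw [e3, e4] at h1
    have h2 : ‖a - (c / 2) • (a + b)‖ ^ 2 ≤ (c / 2 * ‖a + b‖) ^ 2 := by gcongr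
    rw [norm_sub_sq_real, inner_smul_right, norm_smul, Real.norm_of_nonneg (by positivity),
      inner_add_right, real_inner_self_eq_norm_sq] at h2
    have h3 : ‖a‖ ^ 2 ≤ c * (‖a‖ ^ 2 + ⟪a, b⟫) := by linarith
    have h4 := mul_le_mul_of_nonneg_left h3 (show (0:ℝ) ≤ 1 + ρ + κ by positivity)
    rw [← mul_assoc, mul_comm _ c, hc1] at h4
    rw [real_inner_comm]
    linarith)
  refine hstrong.congr fun x _ => ?_
  simp only [hG]
  ring

end Main

/-- strong convexity characterized via the combined second-order
subdifferential. -/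
theorem statement14 (n : ℕ) (φ : EuclideanSpace ℝ (Fin n) → EReal)
    (hnotbot : ∀ x, φ x ≠ ⊥) (hproper : ∃ x, φ x ≠ ⊤)
    (hlsc : LowerSemicontinuous φ) (κ : ℝ) (hκ : 0 < κ) :
    ERealConvex (shiftFun (-κ) φ) ↔
      ∃ ρ : ℝ, 0 ≤ ρ ∧ ERealConvex (shiftFun ρ φ) ∧
        ∀ x y : EuclideanSpace ℝ (Fin n), (x, y) ∈ gphSubdiff ρ φ →
          ∀ w z : EuclideanSpace ℝ (Fin n),
            (z, -w) ∈ regNormalCone (gphSubdiff ρ φ) (x, y) →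
            κ * ‖w‖ ^ 2 ≤ ⟪z, w⟫ := by
  constructor
  · intro h
    obtain ⟨h1, h2⟩ := main_forward φ hnotbot hproper hlsc κ hκ h
    exact ⟨0, le_refl 0, h1, h2⟩
  · rintro ⟨ρ, hρ, h1, h2⟩
    exact main_backward φ hnotbot hproper hlsc κ hκ ρ hρ h1 h2

end
end

section
/- Let φ : ℝⁿ → ℝ ∪ {+∞} be proper and lower semicontinuous, and let κ > 0. Then φ is strongly convex with modulus κ (i.e., x ↦ φ(x) − (κ/2)‖x‖² is convex) if and only if there exists ρ ≥ 0 such that φ is ρ-weakly convex and, for every (x,y) ∈ gph ∂φ and every w, z ∈ ℝⁿ with (z, −w) ∈ N_{gph ∂φ}(x,y), one has ⟨z,w⟩ ≥ κ‖w‖². -/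
open scoped RealInnerProductSpace
open Filter Topology MeasureTheory Set

noncomputable section

variable {n : ℕ}

/-- A Lipschitz map whose derivative is a.e. bounded by one is nonexpansive. -/
lemma lip_of_ae {F : EuclideanSpace ℝ (Fin n) → EuclideanSpace ℝ (Fin n)} {K : NNReal}
    (hF : LipschitzWith K F)
    (h : ∀ᵐ x, DifferentiableAt ℝ F x → ‖fderiv ℝ F x‖ ≤ 1) (p q : EuclideanSpace ℝ (Fin n)) :
    ‖F q - F p‖ ≤ ‖q - p‖ := by
  set v := q - p with hv
  have hae : ∀ᵐ x, DifferentiableAt ℝ F x ∧ ‖fderiv ℝ F x‖ ≤ 1 := by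
    filter_upwards [h, hF.ae_differentiableAt] with x h1 h2 using ⟨h2, h1 h2⟩
  obtain ⟨s, hs, hsm, hsG⟩ := Filter.Eventually.exists_measurable_mem hae
  have h1 : ∀ t : ℝ, ∀ᵐ x : EuclideanSpace ℝ (Fin n), x + t • v ∈ s := fun t =>
    (measurePreserving_add_right volume (t • v)).quasiMeasurePreserving.ae hs
  have h2 : ∀ᵐ x : EuclideanSpace ℝ (Fin n), ∀ᵐ t : ℝ, x + t • v ∈ s := by
    refine (Measure.ae_ae_comm (μ := (volume : Measure ℝ))
      (p := fun t (x : EuclideanSpace ℝ (Fin n)) => x + t • v ∈ s) ?_).1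
      (Filter.Eventually.of_forall h1)
    have : Measurable (fun z : ℝ × EuclideanSpace ℝ (Fin n) => z.2 + z.1 • v) := by fun_prop
    exact this hsm
  have h3 : ∀ᵐ x : EuclideanSpace ℝ (Fin n), ‖F (x + v) - F x‖ ≤ ‖v‖ := by
    filter_upwards [h2] with x hx
    set e := F (x + v) - F x with he
    let f : ℝ → ℝ := fun t => ⟪e, F (x + t • v)⟫
    have hLip : LipschitzWith (‖innerSL ℝ e‖₊ * (K * (0 + ‖v‖₊ ))) f := by
      have hl : LipschitzWith (0 + ‖v‖₊) (fun t : ℝ => x + t • v) := by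
        refine (LipschitzWith.const x).add ?_
        refine LipschitzWith.of_dist_le_mul fun a b => ?_
        rw [dist_eq_norm, dist_eq_norm, ← sub_smul, norm_smul, mul_comm]; rfl
      exact (innerSL ℝ e).lipschitz.comp (hF.comp hl)
    have hac : AbsolutelyContinuousOnInterval f 0 1 :=
      (hLip.lipschitzOnWith).absolutelyContinuousOnInterval
    have hint := hac.integral_deriv_eq_sub
    have hb : ‖∫ t in (0:ℝ)..1, deriv f t‖ ≤ (‖e‖ * ‖v‖) * |(1:ℝ) - 0| := by
      refine intervalIntegral.norm_integral_le_of_norm_le_const_ae ?_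
      filter_upwards [hx] with t ht _
      obtain ⟨hd, hn⟩ := hsG _ ht
      have hl : HasDerivAt (fun t : ℝ => x + t • v) v t := by
        simpa using ((hasDerivAt_id t).smul_const v).const_add x
      have hc : HasDerivAt (fun t : ℝ => F (x + t • v)) (fderiv ℝ F (x + t • v) v) t :=
        hd.hasFDerivAt.comp_hasDerivAt t hl
      have hf : HasDerivAt f ⟪e, fderiv ℝ F (x + t • v) v⟫ t :=
        (innerSL ℝ e).hasFDerivAt.comp_hasDerivAt t hc
      rw [hf.deriv]
      refine (norm_inner_le_norm _ _).trans ?_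
      gcongr
      exact (ContinuousLinearMap.le_opNorm _ _).trans
        (mul_le_of_le_one_left (norm_nonneg _) hn)
    rw [hint] at hb
    have hf1 : f 1 - f 0 = ‖e‖ ^ 2 := by
      simp only [f, one_smul, zero_smul, add_zero]
      rw [← inner_sub_right, ← he, real_inner_self_eq_norm_sq]
    rw [hf1] at hb
    simp only [sub_zero, abs_one, mul_one, norm_pow, norm_norm] at hb
    by_contra! hlt
    nlinarith [norm_nonneg v, norm_nonneg e]
  have hcl : IsClosed {x : EuclideanSpace ℝ (Fin n) | ‖F (x + v) - F x‖ ≤ ‖v‖} := by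
    have := hF.continuous
    exact isClosed_le (by fun_prop) (by fun_prop)
  have hd : Dense {x : EuclideanSpace ℝ (Fin n) | ‖F (x + v) - F x‖ ≤ ‖v‖} :=
    MeasureTheory.Measure.dense_of_ae h3
  have : p ∈ {x : EuclideanSpace ℝ (Fin n) | ‖F (x + v) - F x‖ ≤ ‖v‖} := by
    rw [← hcl.closure_eq]; exact hd p
  simpa [hv] using this


lemma sq_comb (x y : EuclideanSpace ℝ (Fin n)) (a b : ℝ) (hab : a + b = 1) :
    ‖a • x + b • y‖ ^ 2 = a * ‖x‖ ^ 2 + b * ‖y‖ ^ 2 - a * b * ‖x - y‖ ^ 2 := by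
  obtain rfl : b = 1 - a := by linarith
  rw [norm_add_sq_real, norm_sub_sq_real, norm_smul, norm_smul, inner_smul_left, inner_smul_right,
    mul_pow, mul_pow, Real.norm_eq_abs, Real.norm_eq_abs, sq_abs, sq_abs]
  simp only [conj_trivial]
  ring

/-- Real-valued form of `σ`-weak convexity. -/
def WC (φ : EuclideanSpace ℝ (Fin n) → EReal) (σ : ℝ) : Prop :=
  ∀ x y : EuclideanSpace ℝ (Fin n), ∀ a b : ℝ, φ x ≠ ⊤ → φ y ≠ ⊤ → 0 ≤ a → 0 ≤ b → a + b = 1 →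
    φ (a • x + b • y) ≠ ⊤ ∧ (φ (a • x + b • y)).toReal ≤
      a * (φ x).toReal + b * (φ y).toReal + σ / 2 * (a * b * ‖x - y‖ ^ 2)

lemma wc_iff {φ : EuclideanSpace ℝ (Fin n) → EReal} (hb : ∀ x, φ x ≠ ⊥) (σ : ℝ) :
    ERealConvex (shiftFun σ φ) ↔ WC φ σ := by
  have hlift : ∀ x, φ x ≠ ⊤ → ∃ r : ℝ, φ x = r := fun x hx =>
    ⟨(φ x).toReal, (EReal.coe_toReal hx (hb x)).symm⟩
  constructor
  · intro h x y a b hx hy ha hb' hab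
    have h1 := h x y a b ha hb' hab
    obtain ⟨r, hr⟩ := hlift x hx
    obtain ⟨s, hs⟩ := hlift y hy
    simp only [shiftFun, hr, hs] at h1
    have hne : φ (a • x + b • y) ≠ ⊤ := by
      intro htop
      rw [htop, EReal.top_add_coe] at h1
      norm_cast at h1
    refine ⟨hne, ?_⟩
    obtain ⟨t, ht⟩ := hlift _ hne
    rw [ht] at h1
    norm_cast at h1
    rw [ht, hr, hs, EReal.toReal_coe, EReal.toReal_coe, EReal.toReal_coe]
    rw [sq_comb x y a b hab] at h1
    linarith
  · intro h x y a b ha hb' hab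
    by_cases hx : φ x = ⊤
    · rcases ha.eq_or_lt with rfl | ha
      · obtain rfl : b = 1 := by linarith
        simp
      · have h1 : (a : EReal) * shiftFun σ φ x = ⊤ := by
          simp only [shiftFun, hx, EReal.top_add_coe]
          exact EReal.coe_mul_top_of_pos ha
        rw [h1, EReal.top_add_of_ne_bot]
        · exact le_top
        · by_cases hy : φ y = ⊤
          · simp only [shiftFun, hy, EReal.top_add_coe]
            rcases hb'.eq_or_lt with rfl | hb'
            · simp
            · rw [EReal.coe_mul_top_of_pos hb']; simp
          · obtain ⟨s, hs⟩ := hlift y hy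
            simp only [shiftFun, hs]
            norm_cast
            exact EReal.coe_ne_bot _
    · obtain ⟨r, hr⟩ := hlift x hx
      by_cases hy : φ y = ⊤
      · rcases hb'.eq_or_lt with rfl | hb'
        · obtain rfl : a = 1 := by linarith
          simp
        · have h1 : (b : EReal) * shiftFun σ φ y = ⊤ := by
            simp only [shiftFun, hy, EReal.top_add_coe]
            exact EReal.coe_mul_top_of_pos hb'
          rw [h1, EReal.add_top_of_ne_bot]
          · exact le_top
          · simp only [shiftFun, hr]
            norm_cast
            exact EReal.coe_ne_bot _
      · obtain ⟨s, hs⟩ := hlift y hy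
        obtain ⟨h1, h2⟩ := h x y a b hx hy ha hb' hab
        obtain ⟨t, ht⟩ := hlift _ h1
        rw [ht, hr, hs, EReal.toReal_coe, EReal.toReal_coe, EReal.toReal_coe] at h2
        simp only [shiftFun, hr, hs, ht]
        norm_cast
        rw [sq_comb x y a b hab]
        linarith

lemma WC.mono {φ : EuclideanSpace ℝ (Fin n) → EReal} {σ σ' : ℝ} (h : WC φ σ) (hs : σ ≤ σ') :
    WC φ σ' := by
  intro x y a b hx hy ha hb hab
  obtain ⟨h1, h2⟩ := h x y a b hx hy ha hb hab
  refine ⟨h1, h2.trans ?_⟩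
  have : 0 ≤ a * b * ‖x - y‖ ^ 2 := by positivity
  nlinarith

/-- Real-valued form of membership in the subdifferential. -/
def SubG (φ : EuclideanSpace ℝ (Fin n) → EReal) (σ : ℝ) (x y : EuclideanSpace ℝ (Fin n)) : Prop :=
  φ x ≠ ⊤ ∧ ∀ u, φ u ≠ ⊤ →
    (φ x).toReal + ⟪y, u - x⟫ - σ / 2 * ‖u - x‖ ^ 2 ≤ (φ u).toReal

lemma subG_iff {φ : EuclideanSpace ℝ (Fin n) → EReal} (hb : ∀ x, φ x ≠ ⊥) (σ : ℝ)
    (x y : EuclideanSpace ℝ (Fin n)) : (x, y) ∈ gphSubdiff σ φ ↔ SubG φ σ x y := by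
  have hlift : ∀ x, φ x ≠ ⊤ → ∃ r : ℝ, φ x = r := fun x hx =>
    ⟨(φ x).toReal, (EReal.coe_toReal hx (hb x)).symm⟩
  unfold gphSubdiff subdiff SubG
  simp only [Set.mem_ofPred_eq]
  refine and_congr_right fun hx => forall_congr' fun u => ?_
  obtain ⟨r, hr⟩ := hlift x hx
  by_cases hu : φ u = ⊤
  · simp [hu]
  · obtain ⟨s, hs⟩ := hlift u hu
    rw [hr, hs, EReal.toReal_coe, EReal.toReal_coe]
    norm_cast
    simp only [EReal.coe_ne_top, not_false_eq_true, forall_true_left]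
    constructor <;> intro h <;> linarith

/-- A local-type quadratic minorant improves to the convexity modulus. -/
lemma SubG.improve {φ : EuclideanSpace ℝ (Fin n) → EReal} {σ r : ℝ} (h : WC φ σ)
    {x y : EuclideanSpace ℝ (Fin n)} (hxy : SubG φ r x y) : SubG φ σ x y := by
  refine ⟨hxy.1, fun u hu => ?_⟩
  have key : ∀ t ∈ Set.Ioo (0:ℝ) 1, (φ x).toReal + ⟪y, u - x⟫ - σ / 2 * ‖u - x‖ ^ 2 +
      t * ((σ - r) / 2 * ‖u - x‖ ^ 2) ≤ (φ u).toReal := by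
    rintro t ⟨ht0, ht1⟩
    obtain ⟨h1, h2⟩ := h x u (1 - t) t hxy.1 hu (by linarith) ht0.le (by ring)
    have h3 := hxy.2 _ h1
    have e : (1 - t) • x + t • u - x = t • (u - x) := by module
    rw [e, inner_smul_right, norm_smul, mul_pow, Real.norm_eq_abs, sq_abs] at h3
    rw [norm_sub_rev x u] at h2
    have h4 := h3.trans h2
    have : 0 ≤ t * ((φ u).toReal - ((φ x).toReal + ⟪y, u - x⟫ - σ / 2 * ‖u - x‖ ^ 2 +
      t * ((σ - r) / 2 * ‖u - x‖ ^ 2))) := by nlinarith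
    nlinarith [nonneg_of_mul_nonneg_right this ht0]
  have hlim : Tendsto (fun t : ℝ => (φ x).toReal + ⟪y, u - x⟫ - σ / 2 * ‖u - x‖ ^ 2 +
      t * ((σ - r) / 2 * ‖u - x‖ ^ 2)) (𝓝[>] 0)
      (𝓝 ((φ x).toReal + ⟪y, u - x⟫ - σ / 2 * ‖u - x‖ ^ 2 +
      0 * ((σ - r) / 2 * ‖u - x‖ ^ 2))) := by
    refine Tendsto.mono_left ?_ nhdsWithin_le_nhds
    exact Continuous.tendsto (by fun_prop) _
  have := le_of_tendsto hlim (by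
    filter_upwards [Ioo_mem_nhdsGT (zero_lt_one (α := ℝ))] with t ht using key t ht)
  linarith

lemma SubG.monotone {φ : EuclideanSpace ℝ (Fin n) → EReal} {σ : ℝ}
    {x y x' y' : EuclideanSpace ℝ (Fin n)} (h : SubG φ σ x y) (h' : SubG φ σ x' y') :
    -σ * ‖x - x'‖ ^ 2 ≤ ⟪y - y', x - x'⟫ := by
  have h1 := h.2 x' h'.1
  have h2 := h'.2 x h.1
  rw [norm_sub_rev] at h1
  have e : ⟪y, x' - x⟫ = - ⟪y, x - x'⟫ := by rw [← inner_neg_right, neg_sub]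
  rw [inner_sub_left]
  rw [e] at h1
  linarith

/-- Sequential lower semicontinuity in real form. -/
lemma lsc_seq {φ : EuclideanSpace ℝ (Fin n) → EReal} (hb : ∀ x, φ x ≠ ⊥)
    (hl : LowerSemicontinuous φ) {us : ℕ → EuclideanSpace ℝ (Fin n)}
    {u : EuclideanSpace ℝ (Fin n)} {c : ℕ → ℝ} {C : ℝ} (hu : Tendsto us atTop (𝓝 u))
    (hc : Tendsto c atTop (𝓝 C)) (h : ∀ k, φ (us k) ≠ ⊤)
    (hle : ∀ k, (φ (us k)).toReal ≤ c k) : φ u ≠ ⊤ ∧ (φ u).toReal ≤ C := by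
  have h1 : φ u ≤ (C : EReal) := by
    by_contra! hlt
    obtain ⟨d, hd1, hd2⟩ := EReal.lt_iff_exists_real_btwn.1 hlt
    have e1 := hu.eventually (hl u d hd2)
    have e2 := hc.eventually (gt_mem_nhds (EReal.coe_lt_coe_iff.1 hd1))
    obtain ⟨k, hk1, hk2⟩ := (e1.and e2).exists
    have h3 := hle k
    rw [← EReal.coe_toReal (h k) (hb _)] at hk1
    have := EReal.coe_lt_coe_iff.1 hk1
    linarith
  have h2 : φ u ≠ ⊤ := fun h => EReal.coe_ne_top C (top_le_iff.1 (h ▸ h1))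
  refine ⟨h2, ?_⟩
  rw [← EReal.coe_toReal h2 (hb _)] at h1
  exact EReal.coe_le_coe_iff.1 h1

/-- Existence of proximal points. -/
lemma exists_prox {φ : EuclideanSpace ℝ (Fin n) → EReal} (hb : ∀ x, φ x ≠ ⊥)
    (hp : ∃ x, φ x ≠ ⊤) (hl : LowerSemicontinuous φ) {σ r : ℝ} (h : WC φ σ) (hr : σ < r)
    (p : EuclideanSpace ℝ (Fin n)) : ∃ x, SubG φ r x (p - r • x) := by
  obtain ⟨x0, hx0⟩ := hp
  let g : EuclideanSpace ℝ (Fin n) → ℝ := fun u => r / 2 * ‖u‖ ^ 2 - ⟪p, u⟫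
  have hg : Continuous g := by fun_prop
  have hlsc : LowerSemicontinuous (fun u => φ u + (g u : EReal)) := by
    refine hl.add' (continuous_coe_real_ereal.comp hg).lowerSemicontinuous fun x => ?_
    exact EReal.continuousAt_add (.inr (EReal.coe_ne_bot _)) (.inr (EReal.coe_ne_top _))
  let f : EuclideanSpace ℝ (Fin n) → ℝ := fun u => (φ u).toReal + g u
  have hmin : ∀ R : ℝ, 0 ≤ R → ∃ x, φ x ≠ ⊤ ∧ ∀ u, φ u ≠ ⊤ → ‖u - x0‖ ≤ R → f x ≤ f u := by
    intro R hR
    obtain ⟨x, hx, hxm⟩ := (hlsc.lowerSemicontinuousOn (Metric.closedBall x0 R)).exists_isMinOn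
      ⟨x0, Metric.mem_closedBall_self hR⟩ (isCompact_closedBall x0 R)
    have hxt : φ x ≠ ⊤ := by
      intro ht
      have := hxm (Metric.mem_closedBall_self hR)
      simp only [Set.mem_ofPred_eq, ht, EReal.top_add_coe] at this
      rw [← EReal.coe_toReal hx0 (hb _), ← EReal.coe_add] at this
      exact EReal.coe_ne_top _ (top_le_iff.1 this)
    refine ⟨x, hxt, fun u hu hur => ?_⟩
    have := hxm (show u ∈ Metric.closedBall x0 R by rwa [mem_closedBall_iff_norm])
    simp only [Set.mem_ofPred_eq] at this
    rw [← EReal.coe_toReal hu (hb _), ← EReal.coe_toReal hxt (hb _), ← EReal.coe_add,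
      ← EReal.coe_add] at this
    exact EReal.coe_le_coe_iff.1 this
  obtain ⟨x1, hx1, hm1⟩ := hmin 1 zero_le_one
  have hgc : ∀ x u : EuclideanSpace ℝ (Fin n), ∀ a b : ℝ, a + b = 1 →
      g (a • x + b • u) = a * g x + b * g u - r / 2 * (a * b * ‖x - u‖ ^ 2) := by
    intro x u a b hab
    simp only [g, sq_comb x u a b hab, inner_add_right, inner_smul_right]
    ring
  have hbd : ∀ u, φ u ≠ ⊤ → f u ≤ f x0 → ‖u - x0‖ ≤ 1 + 2 * (f x0 - f x1) / (r - σ) := by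
    intro u hu hfu
    have hpos : 0 < r - σ := by linarith
    have h01 : f x1 ≤ f x0 := hm1 x0 hx0 (by simp)
    by_cases h1 : ‖u - x0‖ ≤ 1
    · have : 0 ≤ 2 * (f x0 - f x1) / (r - σ) := by
        apply div_nonneg <;> linarith
      linarith
    push Not at h1
    set R := ‖u - x0‖ with hR
    have hRpos : 0 < R := by linarith
    have hi : R⁻¹ < 1 := inv_lt_one_of_one_lt₀ h1
    obtain ⟨c1, c2⟩ := h x0 u (1 - R⁻¹) R⁻¹ hx0 hu (by linarith) (by positivity) (by ring)
    have c3 := hgc x0 u (1 - R⁻¹) R⁻¹ (by ring)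
    have c4 := hm1 _ c1 (by
      have e : (1 - R⁻¹) • x0 + R⁻¹ • u - x0 = R⁻¹ • (u - x0) := by module
      rw [e, norm_smul, ← hR, Real.norm_eq_abs, abs_of_pos (by positivity)]
      rw [inv_mul_cancel₀ hRpos.ne'])
    have c5 : f ((1 - R⁻¹) • x0 + R⁻¹ • u) ≤ (1 - R⁻¹) * f x0 + R⁻¹ * f u -
        (r - σ) / 2 * ((1 - R⁻¹) * R⁻¹ * R ^ 2) := by
      simp only [f]
      rw [c3]
      rw [norm_sub_rev, ← hR] at c2 ⊢
      linarith
    have e : (1 - R⁻¹) * R⁻¹ * R ^ 2 = R - 1 := by field_simp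
    rw [e] at c5
    have c6 : R⁻¹ * f u ≤ R⁻¹ * f x0 := by gcongr
    have c7 : (r - σ) / 2 * (R - 1) ≤ f x0 - f x1 := by linarith
    have c8 : R - 1 ≤ 2 * (f x0 - f x1) / (r - σ) := by
      rw [le_div_iff₀ hpos]; linarith
    linarith
  obtain ⟨x, hx, hxm⟩ := hmin (max 1 (1 + 2 * (f x0 - f x1) / (r - σ)))
    (le_trans zero_le_one (le_max_left _ _))
  have hall : ∀ u, φ u ≠ ⊤ → f x ≤ f u := by
    intro u hu
    by_cases hc : f u ≤ f x0
    · exact hxm u hu ((hbd u hu hc).trans (le_max_right _ _))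
    · exact (hxm x0 hx0 (by simp)).trans (le_of_not_ge hc)
  refine ⟨x, hx, fun u hu => ?_⟩
  have := hall u hu
  simp only [f, g] at this
  have e1 : ‖u‖ ^ 2 = ‖x‖ ^ 2 + 2 * ⟪x, u - x⟫ + ‖u - x‖ ^ 2 := by
    rw [← norm_add_sq_real]; congr 2; abel
  have e2 : ⟪p, u⟫ = ⟪p, x⟫ + ⟪p, u - x⟫ := by rw [← inner_add_right]; congr 1; abel
  rw [e1, e2] at this
  rw [inner_sub_left, inner_smul_left, conj_trivial]
  linarith


lemma prox_step {φ : EuclideanSpace ℝ (Fin n) → EReal} (hb : ∀ x, φ x ≠ ⊥)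
    (hp : ∃ x, φ x ≠ ⊤) (hl : LowerSemicontinuous φ) {ρ κ κ' : ℝ} (hρ : 0 ≤ ρ) (hκ' : 0 ≤ κ')
    (hκ : κ' < κ) (h : WC φ ρ)
    (hm : ∀ x y x' y', SubG φ ρ x y → SubG φ ρ x' y' → κ * ‖x - x'‖ ^ 2 ≤ ⟪y - y', x - x'⟫)
    {x y : EuclideanSpace ℝ (Fin n)} (hxy : SubG φ ρ x y) (q : EuclideanSpace ℝ (Fin n))
    (hq : φ q ≠ ⊤) : ∃ q', φ q' ≠ ⊤ ∧
      (φ q').toReal - ⟪y, q' - x⟫ - κ' / 2 * ‖q' - x‖ ^ 2 ≤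
        (φ q).toReal - ⟪y, q - x⟫ - κ' / 2 * ‖q - x‖ ^ 2 ∧
      ‖q' - x‖ ≤ (ρ + 1 + κ') / (ρ + 1 + κ) * ‖q - x‖ := by
  obtain ⟨q', hq'⟩ := exists_prox hb hp hl h (lt_add_one ρ) (y - κ' • x + (ρ + 1 + κ') • q)
  have e0 : y - κ' • x + (ρ + 1 + κ') • q - (ρ + 1) • q' =
      y + κ' • (q' - x) + (ρ + 1 + κ') • (q - q') := by module
  rw [e0] at hq'
  refine ⟨q', hq'.1, ?_, ?_⟩
  · have h1 := hq'.2 q hq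
    rw [inner_add_left, inner_add_left, inner_smul_left, inner_smul_left, conj_trivial,
      conj_trivial, real_inner_self_eq_norm_sq] at h1
    have e1 : ‖q - x‖ ^ 2 = ‖q' - x‖ ^ 2 + 2 * ⟪q' - x, q - q'⟫ + ‖q - q'‖ ^ 2 := by
      rw [← norm_add_sq_real]; congr 2; abel
    have e2 : ⟪y, q - x⟫ = ⟪y, q' - x⟫ + ⟪y, q - q'⟫ := by
      rw [← inner_add_right]; congr 1; abel
    rw [e1, e2]
    have : 0 ≤ (ρ + 1 + κ') * ‖q - q'‖ ^ 2 := by positivity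
    nlinarith
  · have h2 := hm q' _ x y (hq'.improve h) hxy
    have e3 : y + κ' • (q' - x) + (ρ + 1 + κ') • (q - q') - y =
        (ρ + 1 + κ') • (q - x) - (ρ + 1) • (q' - x) := by module
    rw [e3, inner_sub_left, inner_smul_left, inner_smul_left, conj_trivial,
      conj_trivial, real_inner_self_eq_norm_sq] at h2
    have h3 := real_inner_le_norm (q - x) (q' - x)
    have hpos : 0 < ρ + 1 + κ := by linarith
    rw [div_mul_eq_mul_div, le_div_iff₀ hpos]
    rcases (norm_nonneg (q' - x)).eq_or_lt with h0 | h0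
    · rw [← h0]; simp only [zero_mul]; positivity
    · have h4 : (ρ + 1 + κ') * ⟪q - x, q' - x⟫ ≤ (ρ + 1 + κ') * (‖q - x‖ * ‖q' - x‖) := by
        gcongr
      have h5 : 0 ≤ ‖q' - x‖ * ((ρ + 1 + κ') * ‖q - x‖ - ‖q' - x‖ * (ρ + 1 + κ)) := by nlinarith
      have := nonneg_of_mul_nonneg_right h5 h0
      linarith

lemma subG_strong_aux {φ : EuclideanSpace ℝ (Fin n) → EReal} (hb : ∀ x, φ x ≠ ⊥)
    (hp : ∃ x, φ x ≠ ⊤) (hl : LowerSemicontinuous φ) {ρ κ κ' : ℝ} (hρ : 0 ≤ ρ) (hκ' : 0 ≤ κ')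
    (hκ : κ' < κ) (h : WC φ ρ)
    (hm : ∀ x y x' y', SubG φ ρ x y → SubG φ ρ x' y' → κ * ‖x - x'‖ ^ 2 ≤ ⟪y - y', x - x'⟫)
    {x y : EuclideanSpace ℝ (Fin n)} (hxy : SubG φ ρ x y) : SubG φ (-κ') x y := by
  refine ⟨hxy.1, fun u hu => ?_⟩
  set θ := (ρ + 1 + κ') / (ρ + 1 + κ) with hθ
  have hpos : 0 < ρ + 1 + κ := by linarith
  have hθ0 : 0 ≤ θ := by positivity
  have hθ1 : θ < 1 := by rw [hθ, div_lt_one hpos]; linarith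
  have hseq : ∀ k : ℕ, ∃ q, φ q ≠ ⊤ ∧
      (φ q).toReal - ⟪y, q - x⟫ - κ' / 2 * ‖q - x‖ ^ 2 ≤
        (φ u).toReal - ⟪y, u - x⟫ - κ' / 2 * ‖u - x‖ ^ 2 ∧
      ‖q - x‖ ≤ θ ^ k * ‖u - x‖ := by
    intro k
    induction k with
    | zero => exact ⟨u, hu, le_rfl, by simp⟩
    | succ k ih =>
      obtain ⟨q, h1, h2, h3⟩ := ih
      obtain ⟨q', h1', h2', h3'⟩ := prox_step hb hp hl hρ hκ' hκ h hm hxy q h1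
      refine ⟨q', h1', h2'.trans h2, h3'.trans ?_⟩
      rw [pow_succ', mul_assoc]
      gcongr
  choose qs hq1 hq2 hq3 using hseq
  have hlim0 : Tendsto (fun k => θ ^ k * ‖u - x‖) atTop (𝓝 0) := by
    simpa using (tendsto_pow_atTop_nhds_zero_of_lt_one hθ0 hθ1).mul_const ‖u - x‖
  have hlim : Tendsto qs atTop (𝓝 x) := by
    rw [tendsto_iff_norm_sub_tendsto_zero]
    exact squeeze_zero (fun _ => norm_nonneg _) hq3 hlim0
  have hc : Tendsto (fun k => (φ u).toReal - ⟪y, u - x⟫ - κ' / 2 * ‖u - x‖ ^ 2 +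
      ⟪y, qs k - x⟫ + κ' / 2 * ‖qs k - x‖ ^ 2) atTop
      (𝓝 ((φ u).toReal - ⟪y, u - x⟫ - κ' / 2 * ‖u - x‖ ^ 2 +
      ⟪y, x - x⟫ + κ' / 2 * ‖x - x‖ ^ 2)) := by
    have hcont : Continuous (fun q => (φ u).toReal - ⟪y, u - x⟫ - κ' / 2 * ‖u - x‖ ^ 2 +
      ⟪y, q - x⟫ + κ' / 2 * ‖q - x‖ ^ 2) := by fun_prop
    exact (hcont.tendsto x).comp hlim
  have := (lsc_seq hb hl hlim hc hq1 (fun k => by linarith [hq2 k])).2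
  simp only [sub_self, inner_zero_right, norm_zero] at this
  linarith

lemma subG_strong {φ : EuclideanSpace ℝ (Fin n) → EReal} (hb : ∀ x, φ x ≠ ⊥)
    (hp : ∃ x, φ x ≠ ⊤) (hl : LowerSemicontinuous φ) {ρ κ : ℝ} (hρ : 0 ≤ ρ) (hκ : 0 < κ)
    (h : WC φ ρ)
    (hm : ∀ x y x' y', SubG φ ρ x y → SubG φ ρ x' y' → κ * ‖x - x'‖ ^ 2 ≤ ⟪y - y', x - x'⟫)
    {x y : EuclideanSpace ℝ (Fin n)} (hxy : SubG φ ρ x y) : SubG φ (-κ) x y := by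
  refine ⟨hxy.1, fun u hu => ?_⟩
  have hlim : Tendsto (fun t : ℝ => (φ x).toReal + ⟪y, u - x⟫ - (-t) / 2 * ‖u - x‖ ^ 2) (𝓝[<] κ)
      (𝓝 ((φ x).toReal + ⟪y, u - x⟫ - (-κ) / 2 * ‖u - x‖ ^ 2)) := by
    refine Tendsto.mono_left ?_ nhdsWithin_le_nhds
    exact Continuous.tendsto (by fun_prop) _
  refine le_of_tendsto hlim ?_
  filter_upwards [Ioo_mem_nhdsLT hκ] with t ht
  exact (subG_strong_aux hb hp hl hρ ht.1.le ht.2 h hm hxy).2 u hu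

lemma wc_of_monotone {φ : EuclideanSpace ℝ (Fin n) → EReal} (hb : ∀ x, φ x ≠ ⊥)
    (hp : ∃ x, φ x ≠ ⊤) (hl : LowerSemicontinuous φ) {ρ κ : ℝ} (hρ : 0 ≤ ρ) (hκ : 0 < κ)
    (h : WC φ ρ)
    (hm : ∀ x y x' y', SubG φ ρ x y → SubG φ ρ x' y' → κ * ‖x - x'‖ ^ 2 ≤ ⟪y - y', x - x'⟫) :
    WC φ (-κ) := by
  intro x1 x2 a b hx1 hx2 ha hb' hab
  obtain ⟨hu, -⟩ := h x1 x2 a b hx1 hx2 ha hb' hab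
  set u := a • x1 + b • x2 with hudef
  have hex : ∀ k : ℕ, ∃ x, SubG φ (-κ) x ((ρ + 1 + k) • (u - x)) := by
    intro k
    obtain ⟨x, hx⟩ := exists_prox hb hp hl h (r := ρ + 1 + k) (by have := Nat.cast_nonneg (α := ℝ) k; linarith)
      ((ρ + 1 + k) • u)
    rw [← smul_sub] at hx
    exact ⟨x, subG_strong hb hp hl hρ hκ h hm (hx.improve h)⟩
  choose us hus using hex
  have hB : ∃ B : ℝ, ∀ k, B ≤ (φ (us k)).toReal := by
    obtain ⟨y0, hy0⟩ : ∃ y0, SubG φ (-κ) (us 0) y0 := ⟨_, hus 0⟩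
    refine ⟨(φ (us 0)).toReal - ‖y0‖ ^ 2 / (2 * κ), fun k => ?_⟩
    have h1 := hy0.2 _ (hus k).1
    have h2 := neg_le_of_abs_le (abs_real_inner_le_norm y0 (us k - us 0))
    have h3 : 0 ≤ (κ * ‖us k - us 0‖ - ‖y0‖) ^ 2 / (2 * κ) := by positivity
    have h4 : (κ * ‖us k - us 0‖ - ‖y0‖) ^ 2 / (2 * κ) =
      κ / 2 * ‖us k - us 0‖ ^ 2 - ‖y0‖ * ‖us k - us 0‖ + ‖y0‖ ^ 2 / (2 * κ) := by
      field_simp; ring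
    linarith
  obtain ⟨B, hB⟩ := hB
  have hbound : ∀ k : ℕ, ‖us k - u‖ ^ 2 ≤ ((φ u).toReal - B) / (k + 1 : ℝ) := by
    intro k
    have h1 := (hus k).2 u hu
    rw [inner_smul_left, conj_trivial, real_inner_self_eq_norm_sq] at h1
    have h2 := hB k
    rw [norm_sub_rev, le_div_iff₀ (by positivity)]
    have h3 : 0 ≤ ρ * ‖u - us k‖ ^ 2 := by positivity
    have h4 : 0 ≤ κ * ‖u - us k‖ ^ 2 := by positivity
    nlinarith
  have hlim2 : Tendsto (fun k => ‖us k - u‖ ^ 2) atTop (𝓝 0) := by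
    refine squeeze_zero (fun _ => by positivity) hbound ?_
    have := (tendsto_one_div_add_atTop_nhds_zero_nat (𝕜 := ℝ)).const_mul ((φ u).toReal - B)
    simpa [div_eq_mul_inv] using this
  have hlim : Tendsto us atTop (𝓝 u) := by
    rw [tendsto_iff_norm_sub_tendsto_zero]
    have := hlim2.sqrt
    simpa [Real.sqrt_sq] using this
  have hcont : Continuous (fun v => a * (φ x1).toReal + b * (φ x2).toReal -
      κ / 2 * (a * ‖x1 - v‖ ^ 2 + b * ‖x2 - v‖ ^ 2)) := by fun_prop
  have hfin := lsc_seq hb hl hlim ((hcont.tendsto u).comp hlim) (fun k => (hus k).1) (by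
    intro k
    have h1 := (hus k).2 x1 hx1
    have h2 := (hus k).2 x2 hx2
    have h1' := mul_le_mul_of_nonneg_left h1 ha
    have h2' := mul_le_mul_of_nonneg_left h2 hb'
    rw [inner_smul_left, conj_trivial] at h1' h2'
    have e : a * ⟪u - us k, x1 - us k⟫ + b * ⟪u - us k, x2 - us k⟫ = ‖u - us k‖ ^ 2 := by
      rw [← inner_smul_right, ← inner_smul_right, ← inner_add_right,
        ← real_inner_self_eq_norm_sq]
      congr 1
      rw [hudef]
      obtain rfl : b = 1 - a := by linarith
      module
    have h3 : 0 ≤ (ρ + 1 + k) * ‖u - us k‖ ^ 2 := by positivity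
    rw [← e] at h3
    have h5 : a * (φ (us k)).toReal + b * (φ (us k)).toReal = (φ (us k)).toReal := by
      rw [← add_mul, hab, one_mul]
    simp only [Function.comp]
    nlinarith)
  refine ⟨hfin.1, hfin.2.trans (le_of_eq ?_)⟩
  have e1 : x1 - u = b • (x1 - x2) := by
    rw [hudef]
    obtain rfl : b = 1 - a := by linarith
    module
  have e2 : x2 - u = (-a) • (x1 - x2) := by
    rw [hudef]
    obtain rfl : b = 1 - a := by linarith
    module
  rw [e1, e2, norm_smul, norm_smul, mul_pow, mul_pow, Real.norm_eq_abs, Real.norm_eq_abs, sq_abs,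
    sq_abs]
  obtain rfl : b = 1 - a := by linarith
  ring


lemma regNormal_strong {φ : EuclideanSpace ℝ (Fin n) → EReal} (hb : ∀ x, φ x ≠ ⊥)
    (hp : ∃ x, φ x ≠ ⊤) (hl : LowerSemicontinuous φ) {κ : ℝ} (hκ : 0 < κ)
    (h : WC φ (-κ)) {x y z w : EuclideanSpace ℝ (Fin n)} (hxy : (x, y) ∈ gphSubdiff 0 φ)
    (hN : (z, -w) ∈ regNormalCone (gphSubdiff 0 φ) (x, y)) : κ * ‖w‖ ^ 2 ≤ ⟪z, w⟫ := by
  rw [subG_iff hb] at hxy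
  have h0 : WC φ 0 := h.mono (by linarith)
  have key : ∀ r : ℝ, 0 < r → r * (κ * ‖w‖ ^ 2 - ⟪z, w⟫) ≤ ‖z‖ ^ 2 - κ * ⟪z, w⟫ := by
    intro r hr
    set e := z + r • w with he
    set c := κ + r with hc
    have hcpos : 0 < c := by positivity
    set K := ‖e‖ / c + (‖e‖ + r * (‖e‖ / c)) + 1 with hK
    have hKpos : 0 < K := by positivity
    have main : ∀ ε > 0, ⟪w, e⟫ - ‖e‖ ^ 2 / c ≤ ε * K := by
      intro ε hε
      obtain ⟨δ, hδ, hδN⟩ := hN ε hε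
      obtain ⟨t, ht, htδ⟩ : ∃ t : ℝ, 0 < t ∧ t * K < δ :=
        ⟨δ / (2 * K), by positivity, by field_simp; norm_num⟩
      obtain ⟨x', hx'⟩ := exists_prox hb hp hl h0 hr (y + r • x - t • e)
      have hx'' := hx'.improve h0
      set a := x' - x with ha
      have ey : y + r • x - t • e - r • x' = y + (-(t • e) - r • a) := by rw [ha]; module
      rw [ey] at hx' hx''
      have hmon := SubG.monotone (hx''.improve h) (hxy.improve h)
      rw [add_sub_cancel_left, ← ha, inner_sub_left, inner_neg_left, inner_smul_left,
        inner_smul_left, conj_trivial, conj_trivial, real_inner_self_eq_norm_sq] at hmon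
      have hcs := neg_le_of_abs_le (abs_real_inner_le_norm e a)
      have hna : ‖a‖ ≤ t * (‖e‖ / c) := by
        rw [← mul_div_assoc, le_div_iff₀ hcpos]
        rcases (norm_nonneg a).eq_or_lt with h0 | h0
        · rw [← h0]; simp only [zero_mul]; positivity
        · have h5 : 0 ≤ ‖a‖ * (t * ‖e‖ - ‖a‖ * c) := by rw [hc]; nlinarith
          linarith [nonneg_of_mul_nonneg_right h5 h0]
      have hny : ‖-(t • e) - r • a‖ ≤ t * (‖e‖ + r * (‖e‖ / c)) := by
        refine (norm_sub_le _ _).trans ?_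
        rw [norm_neg, norm_smul, norm_smul, Real.norm_eq_abs, Real.norm_eq_abs, abs_of_pos ht,
          abs_of_pos hr]
        nlinarith
      have hsub : (x', y + (-(t • e) - r • a)) - (x, y) = (a, -(t • e) - r • a) := by
        rw [Prod.mk_sub_mk, add_sub_cancel_left]
      have hnorm : ‖(x', y + (-(t • e) - r • a)) - (x, y)‖ ≤ t * K := by
        rw [hsub, Prod.norm_mk, hK]
        have h1 : 0 ≤ t * (‖e‖ / c) := by positivity
        have h2 : 0 ≤ t * (‖e‖ + r * (‖e‖ / c)) := by positivity
        apply max_le <;> nlinarith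
      have h6 := hδN (x', y + (-(t • e) - r • a)) ((subG_iff hb _ _ _).2 hx'')
        (hnorm.trans_lt htδ)
      have h7 := h6.trans (mul_le_mul_of_nonneg_left hnorm hε.le)
      rw [hsub] at h7
      simp only [pairInner] at h7
      have e7 : ⟪z, a⟫ + ⟪-w, -(t • e) - r • a⟫ = ⟪e, a⟫ + t * ⟪w, e⟫ := by
        rw [inner_sub_right (-w), inner_neg_neg, inner_smul_right, inner_smul_right, inner_neg_left, he,
          inner_add_left, inner_smul_left, conj_trivial]
        ring
      rw [e7] at h7
      have h8 : ‖e‖ * ‖a‖ ≤ ‖e‖ * (t * (‖e‖ / c)) := by gcongr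
      have h9 : 0 ≤ t * (ε * K - (⟪w, e⟫ - ‖e‖ ^ 2 / c)) := by
        have : ‖e‖ * (t * (‖e‖ / c)) = t * (‖e‖ ^ 2 / c) := by ring
        nlinarith
      linarith [nonneg_of_mul_nonneg_right h9 ht]
    have main2 : ⟪w, e⟫ - ‖e‖ ^ 2 / c ≤ 0 := by
      refine le_of_forall_pos_le_add fun ε hε => ?_
      have := main (ε / K) (by positivity)
      rwa [div_mul_cancel₀ _ hKpos.ne', ← zero_add ε] at this
    have main3 : c * ⟪w, e⟫ ≤ ‖e‖ ^ 2 := by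
      rw [sub_nonpos, le_div_iff₀ hcpos] at main2
      linarith
    rw [he, norm_add_sq_real, inner_add_right, inner_smul_right, inner_smul_right, norm_smul,
      mul_pow, Real.norm_eq_abs, sq_abs, real_inner_self_eq_norm_sq, real_inner_comm z w, hc]
      at main3
    nlinarith
  by_contra! hlt
  have hpos : 0 < κ * ‖w‖ ^ 2 - ⟪z, w⟫ := by linarith
  have := key ((|‖z‖ ^ 2 - κ * ⟪z, w⟫| + 1) / (κ * ‖w‖ ^ 2 - ⟪z, w⟫)) (by positivity)
  rw [div_mul_cancel₀ _ hpos.ne'] at this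
  linarith [le_abs_self (‖z‖ ^ 2 - κ * ⟪z, w⟫)]

lemma limNormal_strong {φ : EuclideanSpace ℝ (Fin n) → EReal} (hb : ∀ x, φ x ≠ ⊥)
    (hp : ∃ x, φ x ≠ ⊤) (hl : LowerSemicontinuous φ) {κ : ℝ} (hκ : 0 < κ)
    (h : WC φ (-κ)) {x y z w : EuclideanSpace ℝ (Fin n)}
    (hN : (z, -w) ∈ limNormalCone (gphSubdiff 0 φ) (x, y)) : κ * ‖w‖ ^ 2 ≤ ⟪z, w⟫ := by
  obtain ⟨zs, vs, h1, -, h3, h4⟩ := hN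
  have hk : ∀ k, κ * ‖(vs k).2‖ ^ 2 ≤ ⟪(vs k).1, -(vs k).2⟫ := by
    intro k
    have := regNormal_strong hb hp hl hκ h (x := (zs k).1) (y := (zs k).2) (z := (vs k).1)
      (w := -(vs k).2) (h1 k) (by rw [neg_neg]; exact h4 k)
    rwa [norm_neg] at this
  have c1 : Continuous (fun v : EuclideanSpace ℝ (Fin n) × EuclideanSpace ℝ (Fin n) =>
    κ * ‖v.2‖ ^ 2) := by fun_prop
  have c2 : Continuous (fun v : EuclideanSpace ℝ (Fin n) × EuclideanSpace ℝ (Fin n) =>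
    ⟪v.1, -v.2⟫) := by fun_prop
  have := le_of_tendsto_of_tendsto' ((c1.tendsto _).comp h3) ((c2.tendsto _).comp h3) hk
  simpa using this

lemma monotone_of_normal {φ : EuclideanSpace ℝ (Fin n) → EReal} (hb : ∀ x, φ x ≠ ⊥)
    (hp : ∃ x, φ x ≠ ⊤) (hl : LowerSemicontinuous φ) {ρ κ : ℝ} (hρ : 0 ≤ ρ) (hκ : 0 < κ)
    (h : WC φ ρ)
    (hN : ∀ x y : EuclideanSpace ℝ (Fin n), (x, y) ∈ gphSubdiff ρ φ →
      ∀ w z : EuclideanSpace ℝ (Fin n), (z, -w) ∈ regNormalCone (gphSubdiff ρ φ) (x, y) →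
        κ * ‖w‖ ^ 2 ≤ ⟪z, w⟫)
    (x y x' y' : EuclideanSpace ℝ (Fin n)) (hxy : SubG φ ρ x y) (hxy' : SubG φ ρ x' y') :
    κ * ‖x - x'‖ ^ 2 ≤ ⟪y - y', x - x'⟫ := by
  set r := ρ + 1 with hr
  have hex : ∀ p, ∃ x, SubG φ ρ x (p - r • x) := fun p => by
    obtain ⟨x, hx⟩ := exists_prox hb hp hl h (lt_add_one ρ) p
    exact ⟨x, hx.improve h⟩
  choose P hP using hex
  have huniq : ∀ x y, SubG φ ρ x y → P (y + r • x) = x := by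
    intro x y hxy
    have h1 := SubG.monotone (hP (y + r • x)) hxy
    have e : y + r • x - r • P (y + r • x) - y = (-r) • (P (y + r • x) - x) := by module
    rw [e, inner_smul_left, conj_trivial, real_inner_self_eq_norm_sq, hr] at h1
    have : ‖P (y + r • x) - x‖ ^ 2 ≤ 0 := by rw [hr]; linarith
    have h2 : ‖P (y + r • x) - x‖ = 0 := by
      exact pow_eq_zero_iff (two_ne_zero) |>.1 (le_antisymm this (by positivity))
    exact sub_eq_zero.1 (norm_eq_zero.1 h2)
  have hLip : LipschitzWith 1 P := by
    refine LipschitzWith.of_dist_le_mul fun p q => ?_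
    rw [dist_eq_norm, dist_eq_norm, NNReal.coe_one, one_mul]
    have h1 := SubG.monotone (hP p) (hP q)
    have e : p - r • P p - (q - r • P q) = (p - q) - r • (P p - P q) := by module
    rw [e, inner_sub_left, inner_smul_left, conj_trivial, real_inner_self_eq_norm_sq, hr] at h1
    have h2 := real_inner_le_norm (p - q) (P p - P q)
    by_contra! hlt
    nlinarith [norm_nonneg (p - q), norm_nonneg (P p - P q)]
  set c := r + κ with hc
  have hcpos : 0 < c := by rw [hc, hr]; linarith
  have hrpos : 0 < r := by rw [hr]; linarith
  have hder : ∀ p, DifferentiableAt ℝ P p → ∀ q,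
      c * ‖ContinuousLinearMap.adjoint (fderiv ℝ P p) q‖ ^ 2 ≤
        ⟪q, ContinuousLinearMap.adjoint (fderiv ℝ P p) q⟫ := by
    intro p hd q
    set w := ContinuousLinearMap.adjoint (fderiv ℝ P p) q with hw
    have hmem : (q - r • w, -w) ∈ regNormalCone (gphSubdiff ρ φ) (P p, p - r • P p) := by
      intro ε hε
      have hlo := hd.hasFDerivAt.isLittleO
      have hpos : 0 < ε / ((‖q‖ + 1) * (1 + r)) := by positivity
      obtain ⟨δ, hδ, hδ'⟩ := Metric.eventually_nhds_iff.1 (hlo.def hpos)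
      refine ⟨δ / (1 + r), by positivity, ?_⟩
      rintro ⟨x', y'⟩ hmem hnorm
      rw [subG_iff hb] at hmem
      have hx' := huniq x' y' hmem
      set p' := y' + r • x' with hp'
      have e1 : p' - p = (y' - (p - r • P p)) + r • (x' - P p) := by rw [hp']; module
      have hn1 : ‖x' - P p‖ ≤ ‖(x', y') - (P p, p - r • P p)‖ := by
        rw [Prod.mk_sub_mk, Prod.norm_mk]; exact le_max_left _ _
      have hn2 : ‖y' - (p - r • P p)‖ ≤ ‖(x', y') - (P p, p - r • P p)‖ := by
        rw [Prod.mk_sub_mk, Prod.norm_mk]; exact le_max_right _ _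
      have hpp : ‖p' - p‖ ≤ (1 + r) * ‖(x', y') - (P p, p - r • P p)‖ := by
        rw [e1]
        refine (norm_add_le _ _).trans ?_
        rw [norm_smul, Real.norm_eq_abs, abs_of_pos hrpos]
        nlinarith
      have hlt : dist p' p < δ := by
        rw [dist_eq_norm]
        rw [lt_div_iff₀ (by positivity)] at hnorm
        linarith
      have h5 := hδ' hlt
      rw [hx'] at h5
      have e2 : pairInner (q - r • w, -w) ((x', y') - (P p, p - r • P p)) =
          ⟪q, x' - P p - fderiv ℝ P p (p' - p)⟫ := by
        simp only [pairInner, Prod.mk_sub_mk]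
        rw [inner_sub_right q, ← ContinuousLinearMap.adjoint_inner_left, ← hw, e1, inner_sub_left,
          inner_add_right w, inner_smul_left, inner_smul_right, conj_trivial, inner_neg_left]
        ring
      rw [e2]
      calc ⟪q, x' - P p - fderiv ℝ P p (p' - p)⟫
          ≤ ‖q‖ * ‖x' - P p - fderiv ℝ P p (p' - p)‖ := real_inner_le_norm _ _
        _ ≤ (‖q‖ + 1) * (ε / ((‖q‖ + 1) * (1 + r)) *
            ((1 + r) * ‖(x', y') - (P p, p - r • P p)‖)) := by
          have := h5.trans (mul_le_mul_of_nonneg_left hpp hpos.le)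
          gcongr
          linarith
        _ = ε * ‖(x', y') - (P p, p - r • P p)‖ := by
          have : ‖q‖ + 1 ≠ 0 := by positivity
          field_simp
    have h6 := hN _ _ ((subG_iff hb _ _ _).2 (hP p)) w _ hmem
    rw [inner_sub_left, inner_smul_left, conj_trivial, real_inner_self_eq_norm_sq] at h6
    rw [hc]
    linarith
  let F : EuclideanSpace ℝ (Fin n) → EuclideanSpace ℝ (Fin n) := fun p => (2 * c) • P p - p
  have hFL : LipschitzWith (‖2 * c‖₊ * 1 + 1) F :=
    ((lipschitzWith_smul (2 * c)).comp hLip).sub LipschitzWith.id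
  have hF1 : ∀ p q, ‖F q - F p‖ ≤ ‖q - p‖ := by
    refine lip_of_ae hFL ?_
    filter_upwards [hLip.ae_differentiableAt] with p hd _
    have hFd : HasFDerivAt F ((2 * c) • fderiv ℝ P p - ContinuousLinearMap.id ℝ _) p :=
      (hd.hasFDerivAt.const_smul (2 * c)).sub (hasFDerivAt_id p)
    rw [hFd.fderiv, ← LinearIsometryEquiv.norm_map ContinuousLinearMap.adjoint]
    refine ContinuousLinearMap.opNorm_le_bound _ zero_le_one fun q => ?_
    rw [one_mul, map_sub, map_smulₛₗ, ContinuousLinearMap.adjoint_id]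
    simp only [conj_trivial, _root_.sub_apply, _root_.smul_apply,
      ContinuousLinearMap.id_apply]
    have h7 := hder p hd q
    refine abs_le_of_sq_le_sq' ?_ (norm_nonneg _) |>.2
    rw [norm_sub_sq_real, norm_smul, mul_pow, Real.norm_eq_abs, sq_abs, inner_smul_left,
      conj_trivial, real_inner_comm]
    nlinarith
  have h8 := hF1 (y' + r • x') (y + r • x)
  simp only [F] at h8
  rw [huniq x y hxy, huniq x' y' hxy'] at h8
  set d := x - x' with hd
  have e3 : (2 * c) • x - (y + r • x) - ((2 * c) • x' - (y' + r • x')) =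
      (2 * c) • d - ((y - y') + r • d) := by rw [hd]; module
  have e4 : y + r • x - (y' + r • x') = (y - y') + r • d := by rw [hd]; module
  rw [e3, e4] at h8
  have h9 := pow_le_pow_left₀ (norm_nonneg _) h8 2
  rw [norm_sub_sq_real, norm_smul, mul_pow, Real.norm_eq_abs, sq_abs, inner_smul_left,
    conj_trivial, inner_add_right, inner_smul_right, real_inner_self_eq_norm_sq,
    real_inner_comm] at h9
  have h10 : 0 ≤ 4 * c * (⟪y - y', d⟫ + r * ‖d‖ ^ 2 - c * ‖d‖ ^ 2) := by nlinarith
  have h11 := nonneg_of_mul_nonneg_right h10 (by positivity)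
  rw [hc] at h11
  linarith

/-- strong convexity characterized via the limiting second-order
subdifferential. -/
theorem statement15 (n : ℕ) (φ : EuclideanSpace ℝ (Fin n) → EReal)
    (hnotbot : ∀ x, φ x ≠ ⊥) (hproper : ∃ x, φ x ≠ ⊤)
    (hlsc : LowerSemicontinuous φ) (κ : ℝ) (hκ : 0 < κ) :
    ERealConvex (shiftFun (-κ) φ) ↔
      ∃ ρ : ℝ, 0 ≤ ρ ∧ ERealConvex (shiftFun ρ φ) ∧
        ∀ x y : EuclideanSpace ℝ (Fin n), (x, y) ∈ gphSubdiff ρ φ →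
          ∀ w z : EuclideanSpace ℝ (Fin n),
            (z, -w) ∈ limNormalCone (gphSubdiff ρ φ) (x, y) →
            κ * ‖w‖ ^ 2 ≤ ⟪z, w⟫ := by
  rw [wc_iff hnotbot]
  constructor
  · intro h
    refine ⟨0, le_rfl, (wc_iff hnotbot 0).2 (h.mono (by linarith)), ?_⟩
    intro x y _ w z hN
    exact limNormal_strong hnotbot hproper hlsc hκ h hN
  · rintro ⟨ρ, hρ, h, hN⟩
    rw [wc_iff hnotbot] at h
    refine wc_of_monotone hnotbot hproper hlsc hρ hκ h
      (monotone_of_normal hnotbot hproper hlsc hρ hκ h ?_)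
    intro x y hxy w z hreg
    exact hN x y hxy w z ⟨fun _ => (x, y), fun _ => (z, -w), fun _ => hxy, tendsto_const_nhds,
      tendsto_const_nhds, fun _ => hreg⟩

end
end

section
/- Let φ : ℝⁿ → ℝ ∪ {+∞} be proper, lower semicontinuous and prox-bounded, i.e., there exist λ₀ > 0 and x₀ ∈ ℝⁿ with e_{λ₀}φ(x₀) > −∞. Then φ is convex if and only if there exists λ > 0 such that e_λφ is convex and there exist λ' > λ and x' ∈ ℝⁿ with e_{λ'}φ(x') > −∞ (i.e., λ is below the prox-boundedness threshold of φ). -/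
open scoped RealInnerProductSpace
open Filter Topology MeasureTheory Set

noncomputable section

variable {n : ℕ}

namespace Stmt16

abbrev EE (n : ℕ) := EuclideanSpace ℝ (Fin n)

lemma lower_bound {n : ℕ} (φ : EE n → EReal) (L : ℝ) (x' : EE n) (h : moreau L φ x' ≠ ⊥) :
    ∃ m : ℝ, ∀ y, ((m - ‖y - x'‖ ^ 2 / (2 * L) : ℝ) : EReal) ≤ φ y := by
  obtain ⟨m, hm⟩ : ∃ m : ℝ, (m : EReal) ≤ moreau L φ x' := by
    induction hh : moreau L φ x' with
    | bot => exact absurd hh h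
    | coe r => exact ⟨r, le_refl _⟩
    | top => exact ⟨0, le_top⟩
  refine ⟨m, fun y => ?_⟩
  have h1 : (m : EReal) ≤ φ y + ((‖y - x'‖ ^ 2 / (2 * L) : ℝ) : EReal) := hm.trans (iInf_le _ y)
  rw [EReal.coe_sub]
  exact EReal.sub_le_of_le_add h1

lemma coercive_real (lam lam' D m G0 : ℝ) (h0 : 0 < lam) (hl : lam < lam') (hD : 0 ≤ D) :
    ∃ R : ℝ, 0 ≤ R ∧ ∀ d : ℝ, ∀ t : ℝ, R ≤ d → d - D ≤ t →
      G0 < m - d ^ 2 / (2 * lam') + t ^ 2 / (2 * lam) := by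
  obtain ⟨A, hA⟩ : ∃ A, A = 1 / (2 * lam) := ⟨_, rfl⟩
  obtain ⟨B, hB⟩ : ∃ B, B = 1 / (2 * lam') := ⟨_, rfl⟩
  have hAB : B < A := by rw [hA, hB]; exact one_div_lt_one_div_of_lt (by linarith) (by linarith)
  have hB0 : 0 < B := by rw [hB]; have : 0 < lam' := h0.trans hl; positivity
  obtain ⟨k, hk⟩ : ∃ k, k = A - B := ⟨_, rfl⟩
  have hkp : 0 < k := by linarith
  have hA0 : 0 < A := by linarith
  refine ⟨1 + D + (2 * A * D + |m - G0|) / k, by positivity, fun d t hd ht => ?_⟩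
  have e1 : d ^ 2 / (2 * lam') = B * d ^ 2 := by rw [hB]; ring
  have e2 : t ^ 2 / (2 * lam) = A * t ^ 2 := by rw [hA]; ring
  rw [e1, e2]
  have hq : 0 ≤ (2 * A * D + |m - G0|) / k := by positivity
  have hdD : 0 ≤ d - D := by linarith
  have h1 : (d - D) ^ 2 ≤ t ^ 2 := pow_le_pow_left₀ hdD ht 2
  have h2 : A * (d - D) ^ 2 ≤ A * t ^ 2 := mul_le_mul_of_nonneg_left h1 hA0.le
  have h3 : k + (2 * A * D + |m - G0|) ≤ k * d := by
    have : k * (1 + (2 * A * D + |m - G0|) / k) ≤ k * d :=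
      mul_le_mul_of_nonneg_left (by linarith) hkp.le
    rwa [mul_add, mul_one, mul_div_cancel₀ _ hkp.ne'] at this
  have hd1 : 1 ≤ d := by linarith
  have h4 : (k + (2 * A * D + |m - G0|)) * d ≤ k * d * d :=
    mul_le_mul_of_nonneg_right h3 (by linarith)
  have h5 : |m - G0| ≤ |m - G0| * d := le_mul_of_one_le_right (abs_nonneg _) hd1
  have h6 : k ≤ k * d := le_mul_of_one_le_right hkp.le hd1
  have h7 := neg_abs_le (m - G0)
  have h8 : 0 ≤ A * D ^ 2 := by positivity
  have h9 : k * d * d = A * d ^ 2 - B * d ^ 2 := by rw [hk]; ring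
  nlinarith

lemma exists_min {n : ℕ} (φ : EE n → EReal)
    (hnotbot : ∀ x, φ x ≠ ⊥) (hproper : ∃ x, φ x ≠ ⊤)
    (hlsc : LowerSemicontinuous φ) (lam lam' : ℝ) (h0 : 0 < lam) (hl : lam < lam')
    (x' : EE n) (hx' : moreau lam' φ x' ≠ ⊥) (x : EE n) :
    ∃ (p : EE n) (c : ℝ), φ p = c ∧
      moreau lam φ x = ((c + ‖p - x‖ ^ 2 / (2 * lam) : ℝ) : EReal) := by
  obtain ⟨m, hm⟩ := lower_bound φ lam' x' hx'
  obtain ⟨y0, hy0⟩ := hproper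
  obtain ⟨c0, hc0⟩ : ∃ c : ℝ, φ y0 = c := ⟨(φ y0).toReal, (EReal.coe_toReal hy0 (hnotbot _)).symm⟩
  set G : EE n → EReal := fun y => φ y + ((‖y - x‖ ^ 2 / (2 * lam) : ℝ) : EReal) with hG
  have hGlsc : LowerSemicontinuous G := by
    refine LowerSemicontinuous.add' hlsc ?_ ?_
    · apply Continuous.lowerSemicontinuous
      exact continuous_coe_real_ereal.comp (by fun_prop)
    · intro y
      exact EReal.continuousAt_add (Or.inr (EReal.coe_ne_bot _)) (Or.inr (EReal.coe_ne_top _))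
  obtain ⟨R, hR0, hR⟩ := coercive_real lam lam' ‖x - x'‖ m (c0 + ‖y0 - x‖ ^ 2 / (2 * lam)) h0 hl
    (norm_nonneg _)
  have hGy0 : G y0 = ((c0 + ‖y0 - x‖ ^ 2 / (2 * lam) : ℝ) : EReal) := by
    simp only [hG, hc0, EReal.coe_add]
  have hout : ∀ y, R ≤ ‖y - x'‖ → G y0 < G y := by
    intro y hy
    have h1 := hR ‖y - x'‖ ‖y - x‖ hy (by
      have := norm_sub_le_norm_sub_add_norm_sub y x x'
      linarith)
    calc G y0 = ((c0 + ‖y0 - x‖ ^ 2 / (2 * lam) : ℝ) : EReal) := hGy0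
      _ < ((m - ‖y - x'‖ ^ 2 / (2 * lam') + ‖y - x‖ ^ 2 / (2 * lam) : ℝ) : EReal) :=
          EReal.coe_lt_coe_iff.2 h1
      _ ≤ G y := by
          rw [EReal.coe_add]
          exact add_le_add_left (hm y) _
  have hne : (Metric.closedBall x' R).Nonempty := ⟨x', Metric.mem_closedBall_self hR0⟩
  obtain ⟨p, hp, hpmin⟩ := (hGlsc.lowerSemicontinuousOn (Metric.closedBall x' R)).exists_isMinOn
    hne (isCompact_closedBall x' R)
  have hin0 : y0 ∈ Metric.closedBall x' R := by
    by_contra hcon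
    rw [Metric.mem_closedBall, dist_eq_norm, not_le] at hcon
    exact lt_irrefl _ (hout y0 hcon.le)
  have hmin : ∀ y, G p ≤ G y := by
    intro y
    by_cases hy : y ∈ Metric.closedBall x' R
    · exact hpmin hy
    · rw [Metric.mem_closedBall, dist_eq_norm, not_le] at hy
      exact (hpmin hin0).trans (hout y hy.le).le
  have hptop : φ p ≠ ⊤ := by
    intro h
    have h1 := hmin y0
    rw [hGy0] at h1
    simp only [hG, h] at h1
    rw [EReal.top_add_coe] at h1
    exact absurd (top_le_iff.1 h1) (EReal.coe_ne_top _)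
  refine ⟨p, (φ p).toReal, (EReal.coe_toReal hptop (hnotbot _)).symm, ?_⟩
  rw [EReal.coe_add, EReal.coe_toReal hptop (hnotbot _)]
  exact le_antisymm (iInf_le G p) (le_iInf hmin)

lemma norm_sq_conv {n : ℕ} (u v : EE n) (a b : ℝ) (ha : 0 ≤ a) (hb : 0 ≤ b) (hab : a + b = 1) :
    ‖a • u + b • v‖ ^ 2 ≤ a * ‖u‖ ^ 2 + b * ‖v‖ ^ 2 := by
  have h1 : ‖a • u + b • v‖ ^ 2 = a ^ 2 * ‖u‖ ^ 2 + 2 * (a * b * ⟪u, v⟫) + b ^ 2 * ‖v‖ ^ 2 := by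
    rw [norm_add_sq_real, real_inner_smul_left, real_inner_smul_right, norm_smul, norm_smul,
      mul_pow, mul_pow, Real.norm_eq_abs, Real.norm_eq_abs, sq_abs, sq_abs]; ring
  have h2 := norm_sub_sq_real u v
  have h3 : 0 ≤ a * b * ‖u - v‖ ^ 2 := by positivity
  rw [h2] at h3
  rw [h1]
  obtain rfl : b = 1 - a := by linarith
  nlinarith

lemma forward {n : ℕ} (φ : EE n → EReal)
    (hnotbot : ∀ x, φ x ≠ ⊥) (hproper : ∃ x, φ x ≠ ⊤)
    (hlsc : LowerSemicontinuous φ) (lam lam' : ℝ) (h0 : 0 < lam) (hl : lam < lam')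
    (x' : EE n) (hx' : moreau lam' φ x' ≠ ⊥) (hconv : ERealConvex φ) :
    ERealConvex (moreau lam φ) := by
  intro x y a b ha hb hab
  obtain ⟨p, c, hc, he⟩ := exists_min φ hnotbot hproper hlsc lam lam' h0 hl x' hx' x
  obtain ⟨q, d, hd, hf⟩ := exists_min φ hnotbot hproper hlsc lam lam' h0 hl x' hx' y
  rw [he, hf]
  refine (iInf_le _ (a • p + b • q)).trans ?_
  refine (add_le_add_left (hconv p q a b ha hb hab) _).trans ?_
  rw [hc, hd]
  norm_cast
  have h1 := norm_sq_conv (p - x) (q - y) a b ha hb hab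
  have h2 : a • p + b • q - (a • x + b • y) = a • (p - x) + b • (q - y) := by module
  rw [h2]
  have h3 : ‖a • (p - x) + b • (q - y)‖ ^ 2 / (2 * lam) ≤
    (a * ‖p - x‖ ^ 2 + b * ‖q - y‖ ^ 2) / (2 * lam) := by gcongr
  have h4 : (a * ‖p - x‖ ^ 2 + b * ‖q - y‖ ^ 2) / (2 * lam) =
    a * (‖p - x‖ ^ 2 / (2 * lam)) + b * (‖q - y‖ ^ 2 / (2 * lam)) := by ring
  linarith

/-- Gradient inequality for a convex envelope. -/
lemma grad_ineq {n : ℕ} (lam : ℝ) (h0 : 0 < lam) (e : EE n → ℝ)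
    (hconv : ∀ x y : EE n, ∀ a b : ℝ, 0 ≤ a → 0 ≤ b → a + b = 1 →
      e (a • x + b • y) ≤ a * e x + b * e y)
    (x p : EE n) (c : ℝ) (hex : e x = c + ‖p - x‖ ^ 2 / (2 * lam))
    (hup : ∀ z, e z ≤ c + ‖p - z‖ ^ 2 / (2 * lam)) (z : EE n) :
    e x + ⟪x - p, z - x⟫ / lam ≤ e z := by
  have key : ∀ t : ℝ, 0 < t →
      e x + ⟪x - p, z - x⟫ / lam - e z ≤ t * (‖z - x‖ ^ 2 / (2 * lam)) := by
    intro t ht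
    have h1 := hconv z (x - t • (z - x)) (t / (1 + t)) (1 / (1 + t)) (by positivity)
      (by positivity) (by field_simp; ring)
    have h2 : (t / (1 + t)) • z + (1 / (1 + t)) • (x - t • (z - x)) = x := by
      match_scalars <;> field_simp <;> ring
    rw [h2] at h1
    have h3 := hup (x - t • (z - x))
    have h4 : ‖p - (x - t • (z - x))‖ ^ 2 =
        ‖p - x‖ ^ 2 - 2 * t * ⟪x - p, z - x⟫ + t ^ 2 * ‖z - x‖ ^ 2 := by
      have : p - (x - t • (z - x)) = (p - x) + t • (z - x) := by module
      rw [this, norm_add_sq_real, real_inner_smul_right, norm_smul, mul_pow, Real.norm_eq_abs,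
        sq_abs, ← neg_sub x p, inner_neg_left]
      ring
    rw [h4] at h3
    have h5 : (1 + t) * e x ≤ t * e z + e (x - t • (z - x)) := by
      have := mul_le_mul_of_nonneg_left h1 (by linarith : 0 ≤ 1 + t)
      calc _ ≤ _ := this
        _ = _ := by field_simp
    have h6 : c + (‖p - x‖ ^ 2 - 2 * t * ⟪x - p, z - x⟫ + t ^ 2 * ‖z - x‖ ^ 2) / (2 * lam)
        = e x - t * (⟪x - p, z - x⟫ / lam) + t * (t * (‖z - x‖ ^ 2 / (2 * lam))) := by
      rw [hex]; field_simp; ring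
    rw [h6] at h3
    have h7 : t * (e x + ⟪x - p, z - x⟫ / lam - e z) ≤ t * (t * (‖z - x‖ ^ 2 / (2 * lam))) := by
      linarith
    exact le_of_mul_le_mul_left h7 ht
  by_contra hcon
  push Not at hcon
  set A := e x + ⟪x - p, z - x⟫ / lam - e z with hA
  have hApos : 0 < A := by linarith
  set B := ‖z - x‖ ^ 2 / (2 * lam) with hB
  have hB0 : 0 ≤ B := by positivity
  have h1 := key (A / (2 * (B + 1))) (by positivity)
  have h2 : A / (2 * (B + 1)) * B ≤ A / 2 := by
    rw [div_mul_eq_mul_div, div_le_div_iff₀ (by positivity) (by positivity)]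
    nlinarith
  linarith

/-- approximate solution of `q = (1-s) P x + s x`. -/
lemma approx_sol {n : ℕ} (lam s : ℝ) (h0 : 0 < lam) (hs : 0 < s) (hs1 : s ≤ 1) (e : EE n → ℝ)
    (P : EE n → EE n) (y0 : EE n) (c0 : ℝ)
    (hup : ∀ z, e z ≤ c0 + ‖y0 - z‖ ^ 2 / (2 * lam))
    (hgrad : ∀ x z, e x + ⟪x - P x, z - x⟫ / lam ≤ e z) (q : EE n) (ε : ℝ) (hε : 0 < ε) :
    ∃ x, ‖x - (1 - s) • (x - P x) - q‖ ≤ ε := by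
  set F : EE n → ℝ := fun x => ‖x‖ ^ 2 / 2 - (1 - s) * (lam * e x) - ⟪q, x⟫ with hF
  have hbdd : BddBelow (range F) := by
    set r : EE n := q - (1 - s) • y0 with hr
    refine ⟨-(‖r‖ ^ 2 / (2 * s)) - (1 - s) * (lam * c0 + ‖y0‖ ^ 2 / 2), ?_⟩
    rintro _ ⟨x, rfl⟩
    have h1 : lam * e x ≤ lam * c0 + ‖y0 - x‖ ^ 2 / 2 := by
      have := mul_le_mul_of_nonneg_left (hup x) h0.le
      calc _ ≤ _ := this
        _ = _ := by field_simp
    have h2 := mul_le_mul_of_nonneg_left h1 (by linarith : 0 ≤ 1 - s)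
    rw [norm_sub_sq_real] at h2
    have h3 : ⟪r, x⟫ = ⟪q, x⟫ - (1 - s) * ⟪y0, x⟫ := by
      rw [hr, inner_sub_left, real_inner_smul_left]
    have h4 : 0 ≤ ‖r - s • x‖ ^ 2 / (2 * s) := by positivity
    have h5 : ‖r - s • x‖ ^ 2 / (2 * s) = ‖r‖ ^ 2 / (2 * s) - ⟪r, x⟫ + s * ‖x‖ ^ 2 / 2 := by
      rw [norm_sub_sq_real, real_inner_smul_right, norm_smul, mul_pow, Real.norm_eq_abs, sq_abs]
      field_simp
    simp only [hF]
    nlinarith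
  obtain ⟨_, ⟨x, rfl⟩, hx⟩ := exists_lt_of_csInf_lt (range_nonempty F)
    (lt_add_of_pos_right (sInf (range F)) (by positivity : 0 < ε ^ 2 / 2))
  refine ⟨x, ?_⟩
  set w := x - (1 - s) • (x - P x) - q with hw
  have h1 : sInf (range F) ≤ F (x - w) := csInf_le hbdd ⟨_, rfl⟩
  have h2 : F (x - w) ≤ F x - ‖w‖ ^ 2 / 2 := by
    have h3 := mul_le_mul_of_nonneg_left (hgrad x (x - w)) h0.le
    have h4 : x - w - x = -w := by abel
    rw [h4, inner_neg_right, mul_add, mul_div_cancel₀ _ h0.ne'] at h3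
    have h5 := mul_le_mul_of_nonneg_left h3 (by linarith : 0 ≤ 1 - s)
    have h6 : ‖w‖ ^ 2 = ⟪x, w⟫ - (1 - s) * ⟪x - P x, w⟫ - ⟪q, w⟫ := by
      rw [← real_inner_self_eq_norm_sq]
      conv_lhs => rw [hw, inner_sub_left, inner_sub_left, real_inner_smul_left, ← hw]
    simp only [hF]
    rw [norm_sub_sq_real, inner_sub_right q x w]
    linarith
  exact abs_le_of_sq_le_sq' (by linarith) hε.le |>.2

lemma small_step (K δ mu d : ℝ) (hδ : 0 < δ) (hδ1 : δ ≤ 1) (hmu : 0 < mu)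
    (hK : 0 ≤ K) (hmK : 2 * mu * K < δ ^ 2) (h : d ^ 2 ≤ mu * (K * (1 + d))) : d < δ := by
  by_contra hcon
  push Not at hcon
  have h1 : δ ^ 2 ≤ d ^ 2 := pow_le_pow_left₀ hδ.le hcon 2
  have h2 : δ ^ 2 * (1 + d) ≤ 2 * d ^ 2 := by
    have : δ ^ 2 * d ≤ d * d := mul_le_mul_of_nonneg_right (by nlinarith) (by linarith)
    nlinarith
  have h3 : 0 < d ^ 2 := by nlinarith
  have h4 : δ ^ 2 * d ^ 2 ≤ mu * K * (2 * d ^ 2) := by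
    have h5 : δ ^ 2 * d ^ 2 ≤ δ ^ 2 * (mu * (K * (1 + d))) :=
      mul_le_mul_of_nonneg_left h (by positivity)
    have h6 : mu * K * (δ ^ 2 * (1 + d)) ≤ mu * K * (2 * d ^ 2) :=
      mul_le_mul_of_nonneg_left h2 (by positivity)
    linarith
  nlinarith

lemma backward {n : ℕ} (φ : EE n → EReal)
    (hnotbot : ∀ x, φ x ≠ ⊥) (hproper : ∃ x, φ x ≠ ⊤)
    (hlsc : LowerSemicontinuous φ) (lam lam' : ℝ) (h0 : 0 < lam) (hl : lam < lam')
    (x' : EE n) (hx' : moreau lam' φ x' ≠ ⊥) (hconv : ERealConvex (moreau lam φ)) :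
    ERealConvex φ := by
  choose P c hc he using exists_min φ hnotbot hproper hlsc lam lam' h0 hl x' hx'
  obtain ⟨e, hedef⟩ : ∃ e : EE n → ℝ, e = fun x => c x + ‖P x - x‖ ^ 2 / (2 * lam) := ⟨_, rfl⟩
  have hee : ∀ x, moreau lam φ x = (e x : EReal) := by intro x; rw [he, hedef]
  have hec : ∀ x y : EE n, ∀ a b : ℝ, 0 ≤ a → 0 ≤ b → a + b = 1 →
      e (a • x + b • y) ≤ a * e x + b * e y := by
    intro x y a b ha hb hab
    have := hconv x y a b ha hb hab
    rw [hee, hee, hee] at this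
    exact_mod_cast this
  have hup : ∀ (y : EE n) (r : ℝ), φ y = r → ∀ z, e z ≤ r + ‖y - z‖ ^ 2 / (2 * lam) := by
    intro y r hr z
    have : moreau lam φ z ≤ φ y + ((‖y - z‖ ^ 2 / (2 * lam) : ℝ) : EReal) := iInf_le _ y
    rw [hee, hr] at this
    exact_mod_cast this
  have hgrad : ∀ x z, e x + ⟪x - P x, z - x⟫ / lam ≤ e z := fun x z =>
    grad_ineq lam h0 e hec x (P x) (c x) (by rw [hedef]) (hup _ _ (hc x)) z
  -- global subgradients
  have hsub : ∀ x u (r : ℝ), φ u = r → c x + ⟪x - P x, u - P x⟫ / lam ≤ r := by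
    intro x u r hr
    have h1 := hgrad x (u + (x - P x))
    have h2 := hup u r hr (u + (x - P x))
    have h3 : u - (u + (x - P x)) = P x - x := by abel
    have h4 : u + (x - P x) - x = u - P x := by abel
    rw [h3] at h2
    rw [h4] at h1
    have h5 : e x = c x + ‖P x - x‖ ^ 2 / (2 * lam) := by rw [hedef]
    linarith
  intro y1 y2 a b ha hb hab
  rcases ha.eq_or_lt with rfl | ha'
  · obtain rfl : b = 1 := by linarith
    simp
  rcases hb.eq_or_lt with rfl | hb'
  · obtain rfl : a = 1 := by linarith
    simp
  have hmulbot : ∀ (t : ℝ) (y : EE n), 0 < t → (t : EReal) * φ y ≠ ⊥ := by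
    intro t y ht
    induction hh : φ y with
    | bot => exact absurd hh (hnotbot y)
    | coe r => exact_mod_cast EReal.coe_ne_bot (t * r)
    | top => rw [EReal.coe_mul_top_of_pos ht]; exact top_ne_bot
  by_cases ht1 : φ y1 = ⊤
  · rw [ht1, EReal.coe_mul_top_of_pos ha', EReal.top_add_of_ne_bot (hmulbot b y2 hb')]
    exact le_top
  by_cases ht2 : φ y2 = ⊤
  · rw [ht2, EReal.coe_mul_top_of_pos hb', EReal.add_top_of_ne_bot (hmulbot a y1 ha')]
    exact le_top
  obtain ⟨r1, hr1⟩ : ∃ r : ℝ, φ y1 = r := ⟨_, (EReal.coe_toReal ht1 (hnotbot _)).symm⟩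
  obtain ⟨r2, hr2⟩ : ∃ r : ℝ, φ y2 = r := ⟨_, (EReal.coe_toReal ht2 (hnotbot _)).symm⟩
  set q := a • y1 + b • y2 with hq
  obtain ⟨C, hC⟩ : ∃ C, C = a * r1 + b * r2 := ⟨_, rfl⟩
  have hgoal : (a : EReal) * φ y1 + (b : EReal) * φ y2 = (C : EReal) := by
    rw [hr1, hr2, hC]; norm_cast
  rw [hgoal]
  have hsubC : ∀ x, c x + ⟪x - P x, q - P x⟫ / lam ≤ C := by
    intro x
    have h1 := mul_le_mul_of_nonneg_left (hsub x y1 r1 hr1) ha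
    have h2 := mul_le_mul_of_nonneg_left (hsub x y2 r2 hr2) hb
    have h3 : q - P x = a • (y1 - P x) + b • (y2 - P x) := by
      rw [hq]
      obtain rfl : b = 1 - a := by linarith
      module
    have h4 : ⟪x - P x, q - P x⟫ / lam =
        a * (⟪x - P x, y1 - P x⟫ / lam) + b * (⟪x - P x, y2 - P x⟫ / lam) := by
      rw [h3, inner_add_right, real_inner_smul_right, real_inner_smul_right]; ring
    have h5 : c x = a * c x + b * c x := by rw [← add_mul, hab, one_mul]
    rw [hC]
    linarith
  -- fixed affine minorant
  obtain ⟨K, hK0, hK⟩ : ∃ K : ℝ, 0 ≤ K ∧ ∀ x, C - c x + ‖q - P x‖ ≤ K * (1 + ‖q - P x‖) := by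
    obtain ⟨v, hv⟩ : ∃ v : EE n, v = (0 : EE n) - P 0 := ⟨_, rfl⟩
    refine ⟨|C - c 0 - ⟪v, q - P 0⟫ / lam| + ‖v‖ / lam + 1, by positivity, fun x => ?_⟩
    have h1 := hsub 0 (P x) (c x) (hc x)
    rw [← hv] at h1
    have h2 : ⟪v, P x - P 0⟫ = ⟪v, q - P 0⟫ - ⟪v, q - P x⟫ := by
      rw [← inner_sub_right]; congr 1; abel
    rw [h2] at h1
    have h3 : ⟪v, q - P x⟫ / lam ≤ ‖v‖ / lam * ‖q - P x‖ := by
      rw [div_mul_eq_mul_div]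
      gcongr
      exact real_inner_le_norm _ _
    have h4 := le_abs_self (C - c 0 - ⟪v, q - P 0⟫ / lam)
    have h5 : 0 ≤ |C - c 0 - ⟪v, q - P 0⟫ / lam| * ‖q - P x‖ := by positivity
    have h6 : 0 ≤ ‖v‖ / lam := by positivity
    rw [sub_div] at h1
    nlinarith
  by_contra hcon
  push Not at hcon
  obtain ⟨C1, hC1, hC1'⟩ := EReal.lt_iff_exists_real_btwn.1 hcon
  have hCC : C < C1 := EReal.coe_lt_coe_iff.1 hC1
  obtain ⟨δ', hδ', hball⟩ := Metric.eventually_nhds_iff.1 (hlsc q _ hC1')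
  obtain ⟨δ, hδ⟩ : ∃ δ, δ = min δ' 1 := ⟨_, rfl⟩
  have hδ0 : 0 < δ := by rw [hδ]; exact lt_min hδ' one_pos
  have hδ1 : δ ≤ 1 := by rw [hδ]; exact min_le_right _ _
  have hδ2 : δ ≤ δ' := by rw [hδ]; exact min_le_left _ _
  obtain ⟨mu, hmu⟩ : ∃ mu, mu = min (min lam 1) (min (δ ^ 2 / (2 * K + 1) / 2) (C1 - C)) :=
    ⟨_, rfl⟩
  have hmu0 : 0 < mu := by
    rw [hmu]
    refine lt_min (lt_min h0 one_pos) (lt_min (by positivity) (by linarith))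
  have hmul : mu ≤ lam := by rw [hmu]; exact (min_le_left _ _).trans (min_le_left _ _)
  have hmu1 : mu ≤ 1 := by rw [hmu]; exact (min_le_left _ _).trans (min_le_right _ _)
  have hmuC : mu ≤ C1 - C := by rw [hmu]; exact (min_le_right _ _).trans (min_le_right _ _)
  have hmuK : 2 * mu * K < δ ^ 2 := by
    have h1 : mu ≤ δ ^ 2 / (2 * K + 1) / 2 := by
      rw [hmu]; exact (min_le_right _ _).trans (min_le_left _ _)
    rw [div_div, le_div_iff₀ (by positivity)] at h1
    have : 0 < δ ^ 2 := by positivity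
    nlinarith
  obtain ⟨x, hx⟩ := approx_sol lam (mu / lam) h0 (by positivity) ((div_le_one h0).2 hmul) e P
    (P 0) (c 0) (hup _ _ (hc 0)) hgrad q (mu * mu) (by positivity)
  set w := x - (1 - mu / lam) • (x - P x) - q with hw
  have hwx : (mu / lam) • (x - P x) = (q - P x) + w := by rw [hw]; module
  have hin : ⟪x - P x, q - P x⟫ / lam * mu = ‖q - P x‖ ^ 2 + ⟪w, q - P x⟫ := by
    rw [← real_inner_self_eq_norm_sq, ← inner_add_left, ← hwx, real_inner_smul_left]; ring
  have hcs : -(mu * mu * ‖q - P x‖) ≤ ⟪w, q - P x⟫ := by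
    have h1 := neg_le_of_abs_le (abs_real_inner_le_norm w (q - P x))
    have h2 := mul_le_mul_of_nonneg_right hx (norm_nonneg (q - P x))
    linarith
  have hmain := mul_le_mul_of_nonneg_left (hsubC x) hmu0.le
  have hd0 := norm_nonneg (q - P x)
  have hKx := hK x
  set d := ‖q - P x‖ with hd
  have hd2 : d ^ 2 ≤ mu * (C - c x + mu * d) := by nlinarith
  have hd3 : d ^ 2 ≤ mu * (K * (1 + d)) := by
    refine hd2.trans (mul_le_mul_of_nonneg_left ?_ hmu0.le)
    nlinarith
  have hdδ : d < δ := small_step K δ mu d hδ0 hδ1 hmu0 hK0 hmuK hd3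
  have hcx : c x ≤ C + mu * d := by
    have : 0 ≤ mu * (C - c x + mu * d) := (sq_nonneg d).trans hd2
    have := nonneg_of_mul_nonneg_right this hmu0
    linarith
  have hlast : (C1 : EReal) < φ (P x) := hball (by
    rw [dist_comm, dist_eq_norm]; exact hdδ.trans_le hδ2)
  rw [hc] at hlast
  have := EReal.coe_lt_coe_iff.1 hlast
  nlinarith

end Stmt16

/-- a prox-bounded proper l.s.c. function is convex iff some Moreau
envelope below the prox-boundedness threshold is convex. -/
theorem statement16 (n : ℕ) (φ : EuclideanSpace ℝ (Fin n) → EReal)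
    (hnotbot : ∀ x, φ x ≠ ⊥) (hproper : ∃ x, φ x ≠ ⊤)
    (hlsc : LowerSemicontinuous φ)
    (hpb : ∃ lam₀ : ℝ, 0 < lam₀ ∧ ∃ x₀ : EuclideanSpace ℝ (Fin n), moreau lam₀ φ x₀ ≠ ⊥) :
    ERealConvex φ ↔
      ∃ lam : ℝ, 0 < lam ∧ ERealConvex (moreau lam φ) ∧
        ∃ lam' : ℝ, lam < lam' ∧ ∃ x' : EuclideanSpace ℝ (Fin n), moreau lam' φ x' ≠ ⊥ := by
  constructor
  · intro h
    obtain ⟨lam₀, h0, x₀, hx₀⟩ := hpb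
    exact ⟨lam₀ / 2, by linarith, Stmt16.forward φ hnotbot hproper hlsc (lam₀ / 2) lam₀
      (by linarith) (by linarith) x₀ hx₀ h, lam₀, by linarith, x₀, hx₀⟩
  · rintro ⟨lam, h0, h, lam', hl, x', hx'⟩
    exact Stmt16.backward φ hnotbot hproper hlsc lam lam' h0 hl x' hx' h

end
end
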